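/- Let k ≥ 1 and d ≥ 2 with d ≥ k² + 3 (equivalently, d ≥ max{r(2k−r)+3 : 1 ≤ r ≤ 2k−1}). Let E ⊆ (ℝ^d)^k be a Jordan measurable set admitting projection bounds (E_r)_{1≤r≤k}. Then there exists a constant C > 0, depending only on d and k, such that 0 ≤ ∫_{X_d} (χ̃_E)² dμ − ( ∫_{X_d} χ̃_E dμ )² ≤ C · max{ vol_{r_1}(E_{r_1}) · vol_{r_2}(E_{r_2}) : 0 ≤ r_1, r_2 ≤ k, 1 ≤ r_1 + r_2 ≤ 2k−1 }, where χ̃_E denotes the rank-k Siegel transform of the characteristic function of E. -/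

import Mathlib

open Matrix MeasureTheory

noncomputable section

instance (m : ℕ) : MeasurableSpace (Matrix (Fin m) (Fin m) ℝ) := MeasurableSpace.pi

noncomputable instance (m : ℕ) : TopologicalSpace (Matrix.SpecialLinearGroup (Fin m) ℝ) :=
  instTopologicalSpaceSubtype

instance (m : ℕ) : MeasurableSpace (Matrix.SpecialLinearGroup (Fin m) ℝ) :=
  Subtype.instMeasurableSpace

abbrev SLR (m : ℕ) := Matrix.SpecialLinearGroup (Fin m) ℝ

/-- `SL_m(ℤ)`, viewed as a subgroup of `SL_m(ℝ)`. -/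
def SLZ (m : ℕ) : Subgroup (SLR m) :=
  (Matrix.SpecialLinearGroup.map (n := Fin m) (Int.castRingHom ℝ)).range

/-- The space `X_m = SL_m(ℝ)/SL_m(ℤ)`. -/
abbrev Xspace (m : ℕ) := SLR m ⧸ SLZ m

/-- Jordan measurability: bounded with null topological boundary. -/
def JordanMeasurable {k d : ℕ} (S : Set (Fin k → Fin d → ℝ)) : Prop :=
  Bornology.IsBounded S ∧ volume (frontier S) = 0

/-- `vol_r`, with the convention `vol_0 = 1`. -/
def jvol (d r : ℕ) (S : Set (Fin r → Fin d → ℝ)) : ℝ :=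
  if r = 0 then 1 else (volume S).toReal

open Matrix MeasureTheory
open scoped ENNReal
open Filter Topology

section Grp
variable {d : ℕ}

theorem meas_entry (i j : Fin d) : Measurable (fun g : SLR d => (g : Matrix (Fin d) (Fin d) ℝ) i j) := by
  have h1 : Measurable (fun g : SLR d => (g : Matrix (Fin d) (Fin d) ℝ)) := measurable_subtype_coe
  have h2 : Measurable (fun M : Matrix (Fin d) (Fin d) ℝ => M i j) :=
    (measurable_pi_apply j).comp (measurable_pi_apply (X := fun _ : Fin d => Fin d → ℝ) i)
  exact h2.comp h1

theorem meas_toSLR {α : Type*} [MeasurableSpace α] (f : α → SLR d)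
    (h : ∀ i j, Measurable (fun a => (f a : Matrix (Fin d) (Fin d) ℝ) i j)) : Measurable f := by
  apply Measurable.subtype_mk (f := fun a => (f a : Matrix (Fin d) (Fin d) ℝ))
  exact measurable_pi_lambda _ fun i => measurable_pi_lambda _ fun j => h i j

instance instMM2 : MeasurableMul₂ (SLR d) := ⟨by
  apply meas_toSLR
  intro i j
  simp only [Matrix.SpecialLinearGroup.coe_mul, Matrix.mul_apply]
  exact Finset.measurable_sum _ fun l _ =>
    ((meas_entry i l).comp measurable_fst).mul ((meas_entry l j).comp measurable_snd)⟩

instance instMInv : MeasurableInv (SLR d) := ⟨by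
  apply meas_toSLR
  intro i j
  simp only [Matrix.SpecialLinearGroup.coe_inv, Matrix.adjugate_apply, Matrix.det_apply]
  refine Finset.measurable_sum _ fun l _ => Measurable.const_smul (Finset.measurable_prod _ fun a _ => ?_) _
  simp only [Matrix.updateRow_apply]
  split_ifs
  · exact measurable_const
  · exact meas_entry _ _⟩

instance instCtbl : Countable (SLZ d) := by
  unfold SLZ
  have : Countable (SpecialLinearGroup (Fin d) ℤ) := by
    have : Countable (Matrix (Fin d) (Fin d) ℤ) := inferInstanceAs (Countable (Fin d → Fin d → ℤ))
    exact Subtype.countable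
  exact (MonoidHom.rangeRestrict_surjective _).countable

theorem meas_mk : Measurable (fun g : SLR d => (QuotientGroup.mk g : Xspace d)) :=
  measurable_quotient_mk''

theorem meas_X {β : Type*} [MeasurableSpace β] (f : Xspace d → β)
    (h : Measurable fun g : SLR d => f (QuotientGroup.mk g)) : Measurable f :=
  measurable_from_quotient.2 h

theorem meas_smulX (γ : SLR d) : Measurable (fun x : Xspace d => γ • x) := by
  apply meas_X
  exact meas_mk.comp (measurable_const_mul γ)

/-- counting measure on a coset -/
def kap : Xspace d → Measure (SLR d) :=
  Quotient.lift (fun g : SLR d => Measure.sum (fun γ : SLZ d => Measure.dirac (g * γ)))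
    (by
      intro a b hab
      have h : a⁻¹ * b ∈ SLZ d := QuotientGroup.leftRel_apply.1 hab
      have hb : b = a * (⟨_, h⟩ : SLZ d) := by simp
      rw [hb]
      ext s hs
      rw [Measure.sum_apply _ hs, Measure.sum_apply _ hs]
      rw [← (Equiv.mulLeft (⟨_, h⟩ : SLZ d)).tsum_eq]
      simp [mul_assoc])

theorem kap_mk (g : SLR d) : kap (QuotientGroup.mk g : Xspace d) =
    Measure.sum (fun γ : SLZ d => Measure.dirac (g * γ)) := rfl

theorem lint_kap (g : SLR d) (f : SLR d → ℝ≥0∞) (hf : Measurable f) :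
    ∫⁻ y, f y ∂(kap (QuotientGroup.mk g : Xspace d)) = ∑' γ : SLZ d, f (g * γ) := by
  rw [kap_mk, lintegral_sum_measure]
  simp [lintegral_dirac' _ hf]

theorem meas_kap : Measurable (kap (d := d)) := by
  apply meas_X
  refine Measure.measurable_of_measurable_coe _ fun s hs => ?_
  simp only [kap_mk, Measure.sum_apply _ hs]
  refine Measurable.tsum fun γ => ?_
  simp only [Measure.dirac_apply' _ hs]
  exact (measurable_one.indicator hs).comp (measurable_mul_const _)

def liftMu (μ : Measure (Xspace d)) : Measure (SLR d) := μ.bind kap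

theorem lint_lift (μ : Measure (Xspace d)) (f : SLR d → ℝ≥0∞) (hf : Measurable f) :
    ∫⁻ y, f y ∂(liftMu μ) = ∫⁻ x, (∫⁻ y, f y ∂(kap x)) ∂μ :=
  Measure.lintegral_bind meas_kap.aemeasurable hf.aemeasurable

theorem lift_inv (μ : Measure (Xspace d)) 
    (hμ : ∀ γ : SLR d, Measure.map (fun x => γ • x) μ = μ) : (liftMu μ).IsMulLeftInvariant := by
  constructor
  intro γ
  ext s hs
  have hm : Measurable (s.indicator (1 : SLR d → ℝ≥0∞)) := measurable_one.indicator hs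
  have hm2 : Measurable (fun a => s.indicator (1 : SLR d → ℝ≥0∞) (γ * a)) :=
    hm.comp (measurable_const_mul γ)
  rw [← lintegral_indicator_one hs, ← lintegral_indicator_one hs,
    lintegral_map hm (measurable_const_mul γ), lint_lift _ _ hm2, lint_lift _ _ hm]
  have hm3 : Measurable (fun x => ∫⁻ y, s.indicator (1 : SLR d → ℝ≥0∞) y ∂(kap x)) :=
    (Measure.measurable_lintegral hm).comp meas_kap
  conv_rhs => rw [← hμ γ]
  rw [lintegral_map hm3 (meas_smulX γ)]
  congr 1
  ext x
  induction x using QuotientGroup.induction_on with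
  | H g =>
    rw [lint_kap _ _ hm2]
    have : γ • (QuotientGroup.mk g : Xspace d) = QuotientGroup.mk (γ * g) := rfl
    rw [this, lint_kap _ _ hm]
    simp [mul_assoc]

end Grp


section Floor
variable {ι κ : Type*} [Fintype ι] [Fintype κ]

def flV (x : ι → κ → ℝ) : ι → κ → ℤ := fun i j => ⌊x i j⌋
def cst (v : ι → κ → ℤ) : ι → κ → ℝ := fun i j => (v i j : ℝ)

theorem meas_flV : Measurable (flV (ι := ι) (κ := κ)) :=
  measurable_pi_lambda _ fun i => measurable_pi_lambda _ fun j =>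
    Int.measurable_floor.comp ((measurable_pi_apply j).comp (measurable_pi_apply i))

theorem map_flV : Measure.map (flV (ι := ι) (κ := κ)) volume = Measure.count := by
  apply Measure.ext_of_singleton
  intro v
  rw [Measure.map_apply meas_flV (MeasurableSet.singleton _), Measure.count_singleton]
  have : flV ⁻¹' {v} = Set.univ.pi fun i : ι => Set.univ.pi fun j : κ => Set.Ico (v i j : ℝ) (v i j + 1) := by
    ext x
    simp only [Set.mem_preimage, Set.mem_singleton_iff, Set.mem_pi, Set.mem_univ, true_imp_iff, Set.mem_Ico]
    constructor
    · rintro rfl i j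
      exact ⟨Int.floor_le _, Int.lt_floor_add_one _⟩
    · intro h
      ext i j
      exact Int.floor_eq_iff.2 (h i j)
  rw [this, volume_pi_pi]
  simp [volume_pi_pi]

theorem tsum_eq_lint (φ : (ι → κ → ℤ) → ℝ≥0∞) : ∑' v, φ v = ∫⁻ x : ι → κ → ℝ, φ (flV x) := by
  rw [← lintegral_count, ← map_flV, lintegral_map (measurable_of_countable _) meas_flV]

theorem norm_sub_flV (x : ι → κ → ℝ) : ‖x - cst (flV x)‖ ≤ 1 := by
  refine (pi_norm_le_iff_of_nonneg zero_le_one).2 fun i => (pi_norm_le_iff_of_nonneg zero_le_one).2 fun j => ?_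
  simp only [Pi.sub_apply, cst, flV, Real.norm_eq_abs, Int.self_sub_floor]
  rw [abs_of_nonneg (Int.fract_nonneg _)]
  exact (Int.fract_lt_one _).le

theorem tsum_norm_fin (L : (ι → κ → ℝ) → (ι → κ → ℝ)) (c : ℝ) (hc : 0 < c)
    (hL : ∀ x, ‖x‖ ≤ c * ‖L x‖) (N : ℝ) (hN : Fintype.card ι * Fintype.card κ < N) :
    ∑' v, ENNReal.ofReal ((1 + ‖L (cst v)‖) ^ (-N)) ≠ ∞ := by
  rw [tsum_eq_lint]
  have h0 : (0:ℝ) ≤ N := le_trans (by positivity) hN.le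
  have h1 := finite_integral_one_add_norm (E := ι → κ → ℝ) (μ := volume) (r := N)
    (by simpa [Module.finrank_pi_fintype] using hN)
  refine ne_top_of_le_ne_top (ENNReal.mul_ne_top (ENNReal.ofReal_ne_top (r := (c+2)^N)) h1.ne) ?_
  rw [← lintegral_const_mul' _ _ ENNReal.ofReal_ne_top]
  refine lintegral_mono fun x => ?_
  dsimp only
  rw [← ENNReal.ofReal_mul (by positivity)]
  apply ENNReal.ofReal_le_ofReal
  have h2 : ‖x‖ ≤ 1 + c * ‖L (cst (flV x))‖ := by
    calc ‖x‖ = ‖(x - cst (flV x)) + cst (flV x)‖ := by simp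
      _ ≤ _ := (norm_add_le _ _).trans (add_le_add (norm_sub_flV x) (hL _))
  have h3 : 1 + ‖x‖ ≤ (c+2) * (1 + ‖L (cst (flV x))‖) := by
    nlinarith [norm_nonneg (L (cst (flV x)))]
  rw [Real.rpow_neg (by positivity), Real.rpow_neg (by positivity), ← div_eq_mul_inv,
    inv_eq_one_div, div_le_div_iff₀ (by positivity) (by positivity), one_mul,
    ← Real.mul_rpow (by positivity) (by positivity)]
  exact Real.rpow_le_rpow (by positivity) h3 h0

end Floor


section Act
variable {d : ℕ} {ι : Type*} [Fintype ι]

def act (g : SLR d) : (ι → Fin d → ℝ) →ₗ[ℝ] (ι → Fin d → ℝ) :=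
  LinearMap.pi fun i => (Matrix.mulVecLin (g : Matrix (Fin d) (Fin d) ℝ)) ∘ₗ LinearMap.proj i

theorem act_apply (g : SLR d) (x : ι → Fin d → ℝ) (i : ι) :
    act g x i = (g : Matrix (Fin d) (Fin d) ℝ) *ᵥ x i := rfl

theorem act_mul (g h : SLR d) (x : ι → Fin d → ℝ) : act (g * h) x = act g (act h x) := by
  ext i; simp [act_apply]

theorem act_one (x : ι → Fin d → ℝ) : act (1 : SLR d) x = x := by
  ext i; simp [act_apply]

theorem act_bound (g : SLR d) : ∃ c > 0, ∀ x : ι → Fin d → ℝ, ‖x‖ ≤ c * ‖act g x‖ := by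
  let A := LinearMap.toContinuousLinearMap (act (ι := ι) g⁻¹)
  refine ⟨‖A‖ + 1, by positivity, fun x => ?_⟩
  have h1 : A (act g x) = x := by
    change act g⁻¹ (act g x) = x
    rw [← act_mul, inv_mul_cancel, act_one]
  have := A.le_opNorm (act g x)
  rw [h1] at this
  nlinarith [norm_nonneg (act g x)]

end Act

section Uniq
variable {d : ℕ}

def colM (g : SLR d) : Fin d → Fin d → ℝ := fun j i => (g : Matrix (Fin d) (Fin d) ℝ) i j

theorem meas_colM : Measurable (colM (d := d)) :=
  measurable_pi_lambda _ fun j => measurable_pi_lambda _ fun i => meas_entry i j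

def wt (g : SLR d) : ℝ≥0∞ := ENNReal.ofReal ((1 + ‖colM g‖) ^ (-((d:ℝ) * d + 1)))

theorem meas_wt : Measurable (wt (d := d)) :=
  (((meas_colM.norm).const_add 1).pow_const _).ennreal_ofReal

theorem wt_ne_zero (g : SLR d) : wt g ≠ 0 := by
  unfold wt
  have : 0 < (1 + ‖colM g‖) ^ (-((d:ℝ) * d + 1)) := Real.rpow_pos_of_pos (by positivity) _
  simpa using this

theorem wt_ne_top (g : SLR d) : wt g ≠ ∞ := ENNReal.ofReal_ne_top

def Wt (g : SLR d) : ℝ≥0∞ := ∑' γ : SLZ d, wt (g * (γ : SLR d))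

theorem meas_Wt : Measurable (Wt (d := d)) :=
  Measurable.tsum fun γ => meas_wt.comp (measurable_mul_const _)

theorem Wt_ne_top (g : SLR d) : Wt g ≠ ∞ := by
  obtain ⟨c, hc, h⟩ := act_bound (ι := Fin d) g
  have h1 := tsum_norm_fin (act (ι := Fin d) g) c hc h ((d:ℝ) * d + 1) (by simp)
  have h2 : ∀ γ : SLZ d, ∃ v : Fin d → Fin d → ℤ, colM (γ : SLR d) = cst v := by
    rintro ⟨_, m, rfl⟩
    exact ⟨fun j i => m i j, rfl⟩
  choose V hV using h2
  have hinj : Function.Injective V := by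
    intro a b hab
    have : colM (a : SLR d) = colM (b : SLR d) := by rw [hV, hV, hab]
    ext i j
    exact congrFun (congrFun this j) i
  refine ne_top_of_le_ne_top h1 ?_
  refine le_trans (le_of_eq ?_) (ENNReal.tsum_comp_le_tsum_of_injective hinj _)
  unfold Wt
  refine tsum_congr fun γ => ?_
  unfold wt
  rw [← hV]
  have : colM (g * (γ : SLR d)) = act g (colM (γ : SLR d)) := by
    ext j i
    simp [colM, act_apply, Matrix.mul_apply, Matrix.mulVec, dotProduct]
  rw [this]

theorem Wt_ne_zero (g : SLR d) : Wt g ≠ 0 := by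
  intro h
  exact wt_ne_zero _ (ENNReal.tsum_eq_zero.1 h 1)

theorem Wt_mul (g : SLR d) (γ : SLZ d) : Wt (g * (γ : SLR d)) = Wt g := by
  unfold Wt
  rw [← (Equiv.mulLeft γ).tsum_eq (fun γ' : SLZ d => wt (g * (γ' : SLR d)))]
  simp [mul_assoc]

def w1 (g : SLR d) : ℝ≥0∞ := wt g / Wt g

theorem meas_w1 : Measurable (w1 (d := d)) := meas_wt.div meas_Wt

theorem w1_ne_zero (g : SLR d) : w1 g ≠ 0 := ENNReal.div_ne_zero.2 ⟨wt_ne_zero g, Wt_ne_top g⟩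
theorem w1_ne_top (g : SLR d) : w1 g ≠ ∞ := ENNReal.div_ne_top (wt_ne_top g) (Wt_ne_zero g)

theorem w1_sum (g : SLR d) : ∑' γ : SLZ d, w1 (g * (γ : SLR d)) = 1 := by
  simp only [w1, Wt_mul, div_eq_mul_inv, ENNReal.tsum_mul_right]
  exact ENNReal.mul_inv_cancel (Wt_ne_zero g) (Wt_ne_top g)

theorem lint_w1 (μ : Measure (Xspace d)) (F : Xspace d → ℝ≥0∞) (hF : Measurable F) :
    ∫⁻ g, F (QuotientGroup.mk g) * w1 g ∂(liftMu μ) = ∫⁻ x, F x ∂μ := by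
  have hm : Measurable fun g : SLR d => F (QuotientGroup.mk g) * w1 g :=
    (hF.comp meas_mk).mul meas_w1
  rw [lint_lift _ _ hm]
  congr 1
  ext x
  induction x using QuotientGroup.induction_on with
  | H g =>
    rw [lint_kap _ _ hm]
    have : ∀ γ : SLZ d, (QuotientGroup.mk (g * γ) : Xspace d) = QuotientGroup.mk g := fun γ =>
      QuotientGroup.mk_mul_of_mem _ γ.2
    simp only [this, ENNReal.tsum_mul_left, w1_sum, mul_one]

theorem sf_lift (μ : Measure (Xspace d)) [IsProbabilityMeasure μ] : SigmaFinite (liftMu μ) := by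
  have h1 : IsFiniteMeasure ((liftMu μ).withDensity w1) := by
    constructor
    rw [withDensity_apply _ MeasurableSet.univ, Measure.restrict_univ]
    have := lint_w1 μ (fun _ => 1) measurable_const
    simp only [one_mul, lintegral_one, measure_univ] at this
    rw [this]; simp
  have h2 := withDensity_inv_same (μ := liftMu μ) meas_w1 (ae_of_all _ w1_ne_zero)
    (ae_of_all _ w1_ne_top)
  rw [← h2]
  apply SigmaFinite.withDensity_of_ne_top
  exact ae_of_all _ fun x => by simpa using w1_ne_zero x

theorem uniq (μ ν : Measure (Xspace d)) [IsProbabilityMeasure μ] [IsProbabilityMeasure ν]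
    (hμ : ∀ γ : SLR d, Measure.map (fun x => γ • x) μ = μ)
    (hν : ∀ γ : SLR d, Measure.map (fun x => γ • x) ν = ν) : μ = ν := by
  have := lift_inv μ hμ
  have := lift_inv ν hν
  have := sf_lift μ
  have := sf_lift ν
  obtain ⟨c, hc⟩ : ∃ c : ℝ≥0∞, liftMu μ = c • liftMu ν := by
    have hne : liftMu ν ≠ 0 := by
      intro h
      have := lint_w1 ν (fun _ => 1) measurable_const
      simp [h] at this
    obtain ⟨s, hs⟩ : ∃ n, liftMu ν (spanningSets (liftMu ν) n) ≠ 0 := by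
      by_contra! h
      apply hne
      rw [← Measure.measure_univ_eq_zero, ← iUnion_spanningSets (liftMu ν)]
      exact measure_iUnion_null h
    exact ⟨_, measure_eq_div_smul (liftMu μ) (liftMu ν) hs (measure_spanningSets_lt_top _ _).ne⟩
  have key : ∀ F : Xspace d → ℝ≥0∞, Measurable F → ∫⁻ x, F x ∂μ = c * ∫⁻ x, F x ∂ν := by
    intro F hF
    rw [← lint_w1 μ F hF, ← lint_w1 ν F hF, hc, lintegral_smul_measure, smul_eq_mul]
  have hc1 : c = 1 := by
    have := key (fun _ => 1) measurable_const
    simpa using this.symm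
  ext s hs
  have := key (s.indicator 1) (measurable_one.indicator hs)
  simpa [lintegral_indicator_one hs, hc1] using this

end Uniq


section Hecke
variable {d : ℕ} {p : ℕ} [Fact p.Prime]

/-- pairing of a functional mod p with an integer vector -/
def pr (l : Fin d → ZMod p) (v : Fin d → ℤ) : ZMod p := ∑ j, l j * (v j : ZMod p)

theorem exists_h (l : Fin d → ZMod p) (hl : l ≠ 0) :
    ∃ h : Matrix (Fin d) (Fin d) ℤ, h.det = p ∧ ∀ v : Fin d → ℤ, (pr l v = 0 ↔ ∃ w, h *ᵥ w = v) := by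
  obtain ⟨i, hi⟩ := Function.ne_iff.1 hl
  simp only [Pi.zero_apply] at hi
  have ha : ∀ j, ∃ a : ℤ, (a : ZMod p) = - l j / l i := fun j => ZMod.intCast_surjective _
  choose a ha using ha
  let u : Fin d → ℤ := fun j => if j = i then p else a j
  have hmv : ∀ w j, (Matrix.updateRow (1 : Matrix (Fin d) (Fin d) ℤ) i u *ᵥ w) j =
      if j = i then p * w i + ∑ j ∈ Finset.univ.erase i, a j * w j else w j := by
    intro w j
    split_ifs with hj
    · subst hj
      simp only [Matrix.mulVec, dotProduct, Matrix.updateRow_self]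
      rw [← Finset.add_sum_erase _ _ (Finset.mem_univ j)]
      congr 1
      · simp [u]
      · refine Finset.sum_congr rfl fun x hx => ?_
        simp [u, Finset.ne_of_mem_erase hx]
    · simp only [Matrix.mulVec, dotProduct, Matrix.updateRow_ne hj]
      simp [Matrix.one_apply]
  have hpr : ∀ v, pr l v = l i * ((v i - ∑ j ∈ Finset.univ.erase i, a j * v j : ℤ) : ZMod p) := by
    intro v
    unfold pr
    rw [← Finset.add_sum_erase _ _ (Finset.mem_univ i)]
    push_cast
    rw [mul_sub, sub_eq_add_neg, Finset.mul_sum, ← Finset.sum_neg_distrib]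
    congr 1
    refine Finset.sum_congr rfl fun x hx => ?_
    rw [ha]; field_simp; try ring
  refine ⟨Matrix.updateRow 1 i u, ?_, fun v => ?_⟩
  · rw [← Matrix.det_transpose, ← Matrix.updateCol_transpose, Matrix.transpose_one, ← Matrix.cramer_apply,
      Matrix.cramer_one]
    simp [u]
  · rw [hpr, mul_eq_zero, or_iff_right hi, ZMod.intCast_zmod_eq_zero_iff_dvd]
    constructor
    · rintro ⟨c, hc⟩
      refine ⟨Function.update v i c, ?_⟩
      ext j
      rw [hmv]
      split_ifs with hj
      · subst hj
        rw [Function.update_self, ← hc]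
        have hs : ∑ x ∈ Finset.univ.erase j, a x * Function.update v j c x =
            ∑ x ∈ Finset.univ.erase j, a x * v x := by
          refine Finset.sum_congr rfl fun x hx => ?_
          rw [Function.update_of_ne (Finset.ne_of_mem_erase hx)]
        rw [hs]; ring
      · rw [Function.update_of_ne hj]
    · rintro ⟨w, rfl⟩
      refine ⟨w i, ?_⟩
      have hs : ∑ x ∈ Finset.univ.erase i, a x * (updateRow 1 i u *ᵥ w) x =
            ∑ x ∈ Finset.univ.erase i, a x * w x := by
        refine Finset.sum_congr rfl fun x hx => ?_
        rw [hmv, if_neg (Finset.ne_of_mem_erase hx)]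
      rw [hs, hmv, if_pos rfl]; ring

variable (d p) in
abbrev NL := {l : Fin d → ZMod p // l ≠ 0}

def hm (l : NL d p) : Matrix (Fin d) (Fin d) ℤ := (exists_h l.1 l.2).choose
theorem hm_det (l : NL d p) : (hm l).det = p := (exists_h l.1 l.2).choose_spec.1
theorem hm_iff (l : NL d p) (v : Fin d → ℤ) : (pr l.1 v = 0 ↔ ∃ w, hm l *ᵥ w = v) :=
  (exists_h l.1 l.2).choose_spec.2 v

variable (d) in
def tt (p : ℕ) : ℝ := (p : ℝ) ^ ((d : ℝ)⁻¹)

theorem tt_pos (hp : p.Prime) : 0 < tt d p := Real.rpow_pos_of_pos (by exact_mod_cast hp.pos) _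
theorem tt_pow (hd : d ≠ 0) : (tt d p) ^ d = p := by
  unfold tt
  exact Real.rpow_inv_natCast_pow (by positivity) hd

theorem d_ne (l : NL d p) : d ≠ 0 := by
  rintro rfl
  exact l.2 (Subsingleton.elim _ _)

def sl (l : NL d p) : SLR d :=
  ⟨(tt d p)⁻¹ • (hm l).map (Int.castRingHom ℝ), by
    rw [Matrix.det_smul]
    have : ((hm l).map (Int.castRingHom ℝ)).det = ((hm l).det : ℝ) := 
      ((Int.castRingHom ℝ).map_det (hm l)).symm
    rw [this, hm_det, inv_pow, Fintype.card_fin, tt_pow (d_ne l)]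
    have hp : (p:ℝ) ≠ 0 := by exact_mod_cast (Fact.out : p.Prime).ne_zero
    simp [hp]⟩

theorem sl_coe (l : NL d p) : (sl l : Matrix (Fin d) (Fin d) ℝ) =
  (tt d p)⁻¹ • (hm l).map (Int.castRingHom ℝ) := rfl

theorem pr_vecMul (l : Fin d → ZMod p) (m : Matrix (Fin d) (Fin d) ℤ) (v : Fin d → ℤ) :
    pr (l ᵥ* (m.map (Int.castRingHom (ZMod p)))) v = pr l (m *ᵥ v) := by
  simp only [pr, Matrix.vecMul, Matrix.mulVec, dotProduct]
  push_cast
  simp only [Finset.sum_mul, Finset.mul_sum]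
  rw [Finset.sum_comm]
  simp [mul_assoc]

theorem coset (γ : SLZ d) : ∃ σ : NL d p → NL d p, Function.Bijective σ ∧ ∀ l, 
    ∃ γ' ∈ SLZ d, (γ : SLR d) * sl l = sl (σ l) * γ' := by
  obtain ⟨_, m, rfl⟩ := γ
  let m' : Matrix (Fin d) (Fin d) (ZMod p) := ((m⁻¹ : SpecialLinearGroup (Fin d) ℤ) : Matrix (Fin d) (Fin d) ℤ).map (Int.castRingHom (ZMod p))
  let m'' : Matrix (Fin d) (Fin d) (ZMod p) := (m : Matrix (Fin d) (Fin d) ℤ).map (Int.castRingHom (ZMod p))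
  have hmi : ((m⁻¹ : SpecialLinearGroup (Fin d) ℤ) : Matrix (Fin d) (Fin d) ℤ) * 
      (m : Matrix (Fin d) (Fin d) ℤ) = 1 := congrArg Subtype.val (inv_mul_cancel m)
  have hmm : m' * m'' = 1 := by
    change (Int.castRingHom (ZMod p)).mapMatrix _ * (Int.castRingHom (ZMod p)).mapMatrix _ = 1
    rw [← map_mul, hmi, map_one]
  have hinj : Function.Injective (fun l : Fin d → ZMod p => l ᵥ* m') := by
    intro a b hab
    have := congrArg (fun z => z ᵥ* m'') hab
    simpa [Matrix.vecMul_vecMul, hmm] using this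
  let σ : NL d p → NL d p := fun l => ⟨l.1 ᵥ* m', fun h => l.2 (hinj (by simpa using h))⟩
  refine ⟨σ, Function.Injective.bijective_of_finite (fun a b hab => Subtype.ext (hinj (congrArg Subtype.val hab))), fun l => ?_⟩
  have h1 : ∀ j, ∃ w, hm (σ l) *ᵥ w = ((m : Matrix (Fin d) (Fin d) ℤ) * hm l) *ᵥ (Pi.single j 1) := by
    intro j
    rw [← hm_iff]
    change pr (l.1 ᵥ* m') _ = 0
    rw [pr_vecMul, Matrix.mulVec_mulVec, ← Matrix.mul_assoc, hmi, one_mul, hm_iff]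
    exact ⟨_, rfl⟩
  choose w hw using h1
  let Q : Matrix (Fin d) (Fin d) ℤ := Matrix.of fun i j => w j i
  have hQ : (m : Matrix (Fin d) (Fin d) ℤ) * hm l = hm (σ l) * Q := by
    ext i j
    have := congrFun (hw j) i
    rw [Matrix.mulVec_single_one] at this
    simp only [Matrix.col_apply] at this
    rw [← this]
    simp [Q, Matrix.mul_apply, Matrix.mulVec, dotProduct]
  have hdet : Q.det = 1 := by
    have := congrArg Matrix.det hQ
    rw [Matrix.det_mul, Matrix.det_mul, hm_det, hm_det, m.2, one_mul] at this
    have hp : (p:ℤ) ≠ 0 := by exact_mod_cast (Fact.out : p.Prime).ne_zero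
    exact (mul_left_cancel₀ hp (by rw [mul_one]; exact this)).symm
  refine ⟨_, ⟨⟨Q, hdet⟩, rfl⟩, ?_⟩
  apply Subtype.ext
  change (m : Matrix (Fin d) (Fin d) ℤ).map (Int.castRingHom ℝ) * ((tt d p)⁻¹ • (hm l).map (Int.castRingHom ℝ))
    = ((tt d p)⁻¹ • (hm (σ l)).map (Int.castRingHom ℝ)) * Q.map (Int.castRingHom ℝ)
  rw [Matrix.mul_smul, Matrix.smul_mul, ← Matrix.map_mul, ← Matrix.map_mul, hQ]

variable (d p) in
def heck : Xspace d → Measure (Xspace d) :=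
  Quotient.lift (fun g : SLR d => Measure.sum (fun l : NL d p => Measure.dirac (QuotientGroup.mk (g * sl l))))
    (by
      intro a b hab
      have h : a⁻¹ * b ∈ SLZ d := QuotientGroup.leftRel_apply.1 hab
      have hb : b = a * (⟨_, h⟩ : SLZ d) := by simp
      obtain ⟨σ, hσ, h2⟩ := coset (p := p) (⟨_, h⟩ : SLZ d)
      rw [hb]
      ext s hs
      rw [Measure.sum_apply _ hs, Measure.sum_apply _ hs]
      rw [← (Equiv.ofBijective σ hσ).tsum_eq]
      refine tsum_congr fun l => ?_
      obtain ⟨γ', hγ', h3⟩ := h2 l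
      rw [mul_assoc, h3, ← mul_assoc, QuotientGroup.mk_mul_of_mem _ hγ']
      rfl)

theorem heck_mk (g : SLR d) : heck d p (QuotientGroup.mk g : Xspace d) =
    Measure.sum (fun l : NL d p => Measure.dirac (QuotientGroup.mk (g * sl l))) := rfl

theorem lint_heck (g : SLR d) (f : Xspace d → ℝ≥0∞) (hf : Measurable f) :
    ∫⁻ y, f y ∂(heck d p (QuotientGroup.mk g : Xspace d)) = ∑ l : NL d p, f (QuotientGroup.mk (g * sl l)) := by
  rw [heck_mk, lintegral_sum_measure]
  simp [lintegral_dirac' _ hf, tsum_fintype]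

theorem meas_heck : Measurable (heck d p) := by
  apply meas_X
  refine Measure.measurable_of_measurable_coe _ fun s hs => ?_
  simp only [heck_mk, Measure.sum_apply _ hs]
  refine Measurable.tsum fun γ => ?_
  simp only [Measure.dirac_apply' _ hs]
  exact (measurable_one.indicator hs).comp (meas_mk.comp (measurable_mul_const _))

theorem card_NL : Fintype.card (NL d p) = p ^ d - 1 := by
  rw [Fintype.card_subtype_compl]
  simp [ZMod.card]

theorem hecke_inv (hd : d ≠ 0) (μ : Measure (Xspace d)) [IsProbabilityMeasure μ]
    (hμ : ∀ γ : SLR d, Measure.map (fun x => γ • x) μ = μ) (F : Xspace d → ℝ≥0∞) (hF : Measurable F) :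
    ∫⁻ x, F x ∂μ = ∫⁻ x, (Fintype.card (NL d p) : ℝ≥0∞)⁻¹ * (∫⁻ y, F y ∂(heck d p x)) ∂μ := by
  set N : ℝ≥0∞ := (Fintype.card (NL d p) : ℝ≥0∞) with hN
  have hN0 : N ≠ 0 := by
    rw [hN, card_NL]
    have : 1 < p ^ d := Nat.one_lt_pow hd (Fact.out : p.Prime).one_lt
    exact_mod_cast (Nat.sub_pos_of_lt this).ne'
  have hNt : N ≠ ∞ := by simp [hN]
  let ν : Measure (Xspace d) := N⁻¹ • μ.bind (heck d p)
  have hν : ∀ f : Xspace d → ℝ≥0∞, Measurable f → ∫⁻ x, f x ∂ν = ∫⁻ x, N⁻¹ * (∫⁻ y, f y ∂(heck d p x)) ∂μ := by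
    intro f hf
    rw [lintegral_smul_measure, Measure.lintegral_bind meas_heck.aemeasurable hf.aemeasurable, smul_eq_mul,
      lintegral_const_mul]
    exact (Measure.measurable_lintegral hf).comp meas_heck
  have hprob : IsProbabilityMeasure ν := by
    constructor
    have := hν (fun _ => 1) measurable_const
    rw [lintegral_one] at this
    rw [this]
    have h1 : ∀ x, N⁻¹ * (∫⁻ y, 1 ∂(heck d p x)) = 1 := by
      intro x
      induction x using QuotientGroup.induction_on with
      | H g =>
        rw [lint_heck _ _ measurable_const]
        simp only [Finset.sum_const, Finset.card_univ, nsmul_eq_mul, mul_one]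
        exact ENNReal.inv_mul_cancel hN0 hNt
    simp only [h1]; simp
  have hinv : ∀ γ : SLR d, Measure.map (fun x => γ • x) ν = ν := by
    intro γ
    ext s hs
    have hm : Measurable (s.indicator (1 : Xspace d → ℝ≥0∞)) := measurable_one.indicator hs
    have hm2 : Measurable (fun a => s.indicator (1 : Xspace d → ℝ≥0∞) (γ • a)) :=
      hm.comp (meas_smulX γ)
    rw [← lintegral_indicator_one hs, ← lintegral_indicator_one hs,
      lintegral_map hm (meas_smulX γ), hν _ hm2, hν _ hm]
    have hm3 : Measurable (fun x => N⁻¹ * ∫⁻ y, s.indicator (1 : Xspace d → ℝ≥0∞) y ∂(heck d p x)) :=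
      ((Measure.measurable_lintegral hm).comp meas_heck).const_mul _
    conv_rhs => rw [← hμ γ]
    rw [lintegral_map hm3 (meas_smulX γ)]
    congr 1
    ext x
    induction x using QuotientGroup.induction_on with
    | H g =>
      rw [lint_heck _ _ hm2]
      have : ∀ g, γ • (QuotientGroup.mk g : Xspace d) = QuotientGroup.mk (γ * g) := fun _ => rfl
      rw [this, lint_heck _ _ hm]
      simp only [this, mul_assoc]
  rw [← hν F hF]
  rw [uniq μ ν hμ hinv]

end Hecke


section Riem
variable {d : ℕ} {ι : Type*} [Fintype ι]

theorem act_det (g : SLR d) : LinearMap.det (act (ι := ι) g) = 1 := by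
  classical
  unfold act
  rw [LinearMap.det_pi]
  have : LinearMap.det (Matrix.mulVecLin (g : Matrix (Fin d) (Fin d) ℝ)) = 1 := by
    rw [← Matrix.toLin'_apply', LinearMap.det_toLin']
    exact g.2
  simp [this]

theorem vol_act (g : SLR d) (A : Set (ι → Fin d → ℝ)) : volume (act g ⁻¹' A) = volume A := by
  rw [Measure.addHaar_preimage_linearMap _ (by rw [act_det]; simp), act_det]
  simp

theorem cont_act (g : SLR d) : Continuous (act (ι := ι) g) := LinearMap.continuous_of_finiteDimensional _

/-- rescaled lattice sum -/
def RS (g : SLR d) (A : Set (ι → Fin d → ℝ)) (t : ℝ) : ℝ≥0∞ :=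
  ENNReal.ofReal (t ^ (d * Fintype.card ι))⁻¹ * ∑' V : ι → Fin d → ℤ, A.indicator 1 (t⁻¹ • act g (cst V))

theorem RS_eq (g : SLR d) (A : Set (ι → Fin d → ℝ)) (t : ℝ) (ht : 0 < t) :
    RS g A t = ∫⁻ x, A.indicator (1 : (ι → Fin d → ℝ) → ℝ≥0∞) (t⁻¹ • act g (cst (flV (t • x)))) := by
  unfold RS
  rw [tsum_eq_lint]
  have h := Measure.map_addHaar_smul (volume : Measure (ι → Fin d → ℝ)) ht.ne'
  have hm : Measurable fun x : ι → Fin d → ℝ => A.indicator (1 : (ι → Fin d → ℝ) → ℝ≥0∞) (t⁻¹ • act g (cst (flV x))) :=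
    (measurable_of_countable (fun V : ι → Fin d → ℤ => A.indicator (1 : (ι → Fin d → ℝ) → ℝ≥0∞) (t⁻¹ • act g (cst V)))).comp meas_flV
  have h2 := lintegral_map (μ := volume) hm (measurable_const_smul t)
  rw [← h2, h, lintegral_smul_measure, smul_eq_mul]
  congr 2
  rw [abs_of_pos (by positivity)]
  congr 2
  simp [Module.finrank_pi_fintype, mul_comm]

theorem meas_RSint (g : SLR d) (A : Set (ι → Fin d → ℝ)) (t : ℝ) :
    Measurable fun x : ι → Fin d → ℝ => A.indicator (1 : (ι → Fin d → ℝ) → ℝ≥0∞) (t⁻¹ • act g (cst (flV (t • x)))) :=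
  (measurable_of_countable (fun V : ι → Fin d → ℤ => A.indicator (1 : (ι → Fin d → ℝ) → ℝ≥0∞) (t⁻¹ • act g (cst V)))).comp
    (meas_flV.comp (measurable_const_smul t))

theorem near (x : ι → Fin d → ℝ) (t : ℝ) (ht : 0 < t) : ‖x - t⁻¹ • cst (flV (t • x))‖ ≤ t⁻¹ := by
  have : x - t⁻¹ • cst (flV (t • x)) = t⁻¹ • (t • x - cst (flV (t • x))) := by
    rw [smul_sub, smul_smul, inv_mul_cancel₀ ht.ne', one_smul]
  rw [this, norm_smul, Real.norm_of_nonneg (by positivity)]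
  exact mul_le_of_le_one_right (by positivity) (norm_sub_flV _)

theorem tend_pt (g : SLR d) (t : ℕ → ℝ) (ht : ∀ n, 1 ≤ t n) (htt : Tendsto t atTop atTop) (x : ι → Fin d → ℝ) :
    Tendsto (fun n => (t n)⁻¹ • act g (cst (flV (t n • x)))) atTop (𝓝 (act g x)) := by
  have h1 : Tendsto (fun n => (t n)⁻¹ • cst (flV (t n • x))) atTop (𝓝 x) := by
    rw [tendsto_iff_norm_sub_tendsto_zero]
    refine squeeze_zero (fun _ => norm_nonneg _) (fun n => ?_) (tendsto_inv_atTop_zero.comp htt)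
    rw [norm_sub_rev]
    exact near x _ (lt_of_lt_of_le one_pos (ht n))
  have := ((cont_act g).tendsto x).comp h1
  simpa [Function.comp_def] using this

theorem RS_upper (g : SLR d) (A : Set (ι → Fin d → ℝ)) (hA : IsCompact A) 
    (t : ℕ → ℝ) (ht : ∀ n, 1 ≤ t n) (htt : Tendsto t atTop atTop) :
    limsup (fun n => RS g A (t n)) atTop ≤ volume A := by
  have hp : ∀ n, 0 < t n := fun n => lt_of_lt_of_le one_pos (ht n)
  simp only [fun n => RS_eq g A (t n) (hp n)]
  obtain ⟨c, hc, hb⟩ := act_bound (ι := ι) g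
  obtain ⟨R, hR⟩ := hA.isBounded.exists_norm_le
  refine (limsup_lintegral_le ((Metric.closedBall (0 : ι → Fin d → ℝ) (c * R + 1)).indicator (1 : (ι → Fin d → ℝ) → ℝ≥0∞))
    (fun n => meas_RSint g A (t n)) (fun n => ae_of_all _ fun x => ?_) ?_).trans ?_
  · by_cases hx : (t n)⁻¹ • act g (cst (flV (t n • x))) ∈ A
    · have h1 := hR _ hx
      rw [← map_smul] at h1
      have h2 := (hb ((t n)⁻¹ • cst (flV (t n • x)))).trans (mul_le_mul_of_nonneg_left h1 hc.le)
      have h3 := near x (t n) (hp n)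
      have h4 : ‖x‖ ≤ c * R + 1 := by
        calc ‖x‖ = ‖(x - (t n)⁻¹ • cst (flV (t n • x))) + (t n)⁻¹ • cst (flV (t n • x))‖ := by simp
          _ ≤ (t n)⁻¹ + c * R := (norm_add_le _ _).trans (add_le_add h3 h2)
          _ ≤ _ := by linarith [inv_le_one_of_one_le₀ (ht n)]
      have h5 : x ∈ Metric.closedBall (0 : ι → Fin d → ℝ) (c * R + 1) := by simpa using h4
      simp [Set.indicator_of_mem hx, Set.indicator_of_mem h5]
    · simp [Set.indicator_of_notMem hx]
  · rw [lintegral_indicator_one Metric.isClosed_closedBall.measurableSet]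
    exact (measure_closedBall_lt_top).ne
  · rw [← vol_act g A, ← lintegral_indicator_one ((cont_act g).measurable hA.measurableSet)]
    refine lintegral_mono fun x => ?_
    have h1 := tend_pt g t ht htt x
    by_cases hx : act g x ∈ A
    · rw [Set.indicator_of_mem (show x ∈ act g ⁻¹' A from hx)]
      refine limsup_le_of_le (by isBoundedDefault) (Eventually.of_forall fun n => ?_)
      exact Set.indicator_le_self' (fun _ _ => zero_le) _
    · have h2 := h1 (hA.isClosed.isOpen_compl.mem_nhds hx)
      have h3 : ∀ᶠ n in atTop, A.indicator (1 : (ι → Fin d → ℝ) → ℝ≥0∞) ((t n)⁻¹ • act g (cst (flV (t n • x)))) = 0 := by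
        filter_upwards [h2] with n hn
        exact Set.indicator_of_notMem hn _
      rw [limsup_congr h3]
      simp

theorem RS_lower (g : SLR d) (A : Set (ι → Fin d → ℝ)) (hA : IsOpen A) 
    (t : ℕ → ℝ) (ht : ∀ n, 1 ≤ t n) (htt : Tendsto t atTop atTop) :
    volume A ≤ liminf (fun n => RS g A (t n)) atTop := by
  have hp : ∀ n, 0 < t n := fun n => lt_of_lt_of_le one_pos (ht n)
  simp only [fun n => RS_eq g A (t n) (hp n)]
  refine le_trans ?_ (lintegral_liminf_le (fun n => meas_RSint g A (t n)))
  rw [← vol_act g A, ← lintegral_indicator_one ((cont_act g).measurable hA.measurableSet)]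
  refine lintegral_mono fun x => ?_
  have h1 := tend_pt g t ht htt x
  by_cases hx : act g x ∈ A
  · have h2 := h1 (hA.mem_nhds hx)
    have h3 : ∀ᶠ n in atTop, A.indicator (1 : (ι → Fin d → ℝ) → ℝ≥0∞) ((t n)⁻¹ • act g (cst (flV (t n • x)))) = 1 := by
      filter_upwards [h2] with n hn
      exact Set.indicator_of_mem (s := A) (M := ℝ≥0∞) hn _
    rw [liminf_congr h3, Set.indicator_of_mem (show x ∈ act g ⁻¹' A from hx)]
    simp
  · rw [Set.indicator_of_notMem (show x ∉ act g ⁻¹' A from hx)]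
    exact zero_le

end Riem


section Count
variable {d : ℕ} {p : ℕ} [Fact p.Prime] {ι : Type*} [Fintype ι]

/-- all pairings -/
def prL (p : ℕ) [Fact p.Prime] (V : ι → Fin d → ℤ) : (Fin d → ZMod p) →ₗ[ZMod p] (ι → ZMod p) :=
  Matrix.mulVecLin (Matrix.of fun i j => (V i j : ZMod p))

theorem prL_apply (V : ι → Fin d → ℤ) (l : Fin d → ZMod p) (i : ι) : prL p V l i = pr l (V i) := by
  simp [prL, pr, Matrix.mulVec, dotProduct, mul_comm]

open Classical in
def cnt (p : ℕ) [Fact p.Prime] (V : ι → Fin d → ℤ) : ℕ :=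
  Fintype.card {l : NL d p // ∀ i, pr l.1 (V i) = 0}

theorem card_ker (V : ι → Fin d → ℤ) : Nat.card (LinearMap.ker (prL p V)) = cnt p V + 1 := by
  classical
  unfold cnt
  rw [← Fintype.card_option, ← Nat.card_eq_fintype_card]
  apply Nat.card_congr
  have h0 : ∀ l, l ∈ LinearMap.ker (prL p V) ↔ ∀ i, pr l (V i) = 0 := by
    intro l
    rw [LinearMap.mem_ker, funext_iff]
    simp [prL_apply]
  refine 
    { toFun := fun l => if h : l.1 = 0 then none else some ⟨⟨l.1, h⟩, (h0 _).1 l.2⟩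
      invFun := fun o => o.elim 0 (fun l => ⟨l.1.1, (h0 _).2 l.2⟩)
      left_inv := ?_
      right_inv := ?_ }
  · intro l
    by_cases h : l.1 = 0
    · simp [h]; exact (Subtype.ext h).symm
    · simp [h]
  · rintro (_ | l)
    · simp
    · simp [l.1.2]

theorem ker_range (V : ι → Fin d → ℤ) : 
    Nat.card (LinearMap.ker (prL p V)) * Nat.card (LinearMap.range (prL p V)) = p ^ d := by
  have h1 := Submodule.card_eq_card_quotient_mul_card (LinearMap.ker (prL p V))
  rw [Nat.card_congr (prL p V).quotKerEquivRange.toEquiv] at h1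
  rw [mul_comm] at h1
  simpa [Nat.card_eq_fintype_card, ZMod.card, mul_comm] using h1.symm

theorem card_fun : Nat.card (ι → ZMod p) = p ^ Fintype.card ι := by
  rw [Nat.card_fun, Nat.card_zmod, Nat.card_eq_fintype_card]

theorem cnt_ge (V : ι → Fin d → ℤ) (h : Fintype.card ι ≤ d) : p ^ (d - Fintype.card ι) ≤ cnt p V + 1 := by
  rw [← card_ker]
  have h1 : Nat.card (LinearMap.range (prL p V)) ≤ p ^ (Fintype.card ι) := by
    refine (Nat.card_mono (Set.toFinite (Set.univ : Set (ι → ZMod p))) (Set.subset_univ (LinearMap.range (prL p V) : Set (ι → ZMod p)))).trans ?_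
    rw [Nat.card_congr (Equiv.Set.univ (ι → ZMod p)), card_fun]
  have h2 := ker_range (p := p) V
  have hp : 0 < p ^ Fintype.card ι := pow_pos (Fact.out : p.Prime).pos _
  refine Nat.le_of_mul_le_mul_right ?_ hp
  rw [← pow_add, Nat.sub_add_cancel h, ← h2]
  exact Nat.mul_le_mul_left _ h1

theorem cnt_eq (V : ι → Fin d → ℤ) (h : Fintype.card ι ≤ d) (hs : Function.Surjective (prL p V)) :
    cnt p V + 1 = p ^ (d - Fintype.card ι) := by
  rw [← card_ker]
  have h2 := ker_range (p := p) V
  rw [LinearMap.range_eq_top.2 hs] at h2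
  have h3 : Nat.card (⊤ : Submodule (ZMod p) (ι → ZMod p)) = p ^ Fintype.card ι := by
    rw [Nat.card_congr (Submodule.topEquiv (R := ZMod p) (M := ι → ZMod p)).toEquiv, card_fun]
  rw [h3] at h2
  have hp : 0 < p ^ Fintype.card ι := pow_pos (Fact.out : p.Prime).pos _
  refine Nat.eq_of_mul_eq_mul_right hp ?_
  rw [h2, ← pow_add, Nat.sub_add_cancel h]

theorem exists_minor [DecidableEq ι] (V : ι → Fin d → ℤ) (hV : LinearIndependent ℤ V) :
    ∃ J : ι → Fin d, Function.Injective J ∧ (Matrix.of fun i j => V i (J j)).det ≠ 0 := by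
  let W : Matrix ι (Fin d) ℚ := Matrix.of fun i j => (V i j : ℚ)
  have hW : LinearIndependent ℚ W.row := by
    have h1 : LinearIndependent ℤ W.row := by
      let f : (Fin d → ℤ) →ₗ[ℤ] (Fin d → ℚ) := LinearMap.pi fun j => 
        (Int.castAddHom ℚ).toIntLinearMap ∘ₗ LinearMap.proj j
      have hf : W.row = f ∘ V := by
        ext i j; simp [W, f, Matrix.row]
      rw [hf]
      apply hV.map'
      rw [LinearMap.ker_eq_bot]
      intro a b hab
      ext j
      have := congrFun hab j
      simpa [f] using this
    exact (LinearIndependent.iff_fractionRing (R := ℤ) (K := ℚ)).1 h1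
  have hr : W.rank = Fintype.card ι := hW.rank_matrix
  obtain ⟨κ, a, ha, hsp, hli⟩ := exists_linearIndependent' ℚ W.col
  have : Fintype κ := Fintype.ofInjective a ha
  have hcard : Fintype.card κ = Fintype.card ι := by
    rw [← hr, Matrix.rank_eq_finrank_span_cols, ← hsp]
    exact (finrank_span_eq_card hli).symm
  let e : ι ≃ κ := (Fintype.equivOfCardEq hcard).symm
  refine ⟨a ∘ e, ha.comp e.injective, fun h0 => ?_⟩
  have hli2 : LinearIndependent ℚ ((W.col ∘ a) ∘ e) := hli.comp e e.injective
  have hu : IsUnit (Matrix.of fun i j => W i (a (e j))) := by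
    rw [← Matrix.linearIndependent_cols_iff_isUnit]
    exact hli2
  rw [Matrix.isUnit_iff_isUnit_det] at hu
  apply hu.ne_zero
  have := congrArg (Int.castRingHom ℚ) h0
  rw [(Int.castRingHom ℚ).map_det] at this
  rw [map_zero] at this
  exact this

theorem surj_of_minor [DecidableEq ι] (V : ι → Fin d → ℤ) (J : ι → Fin d) (hJ : Function.Injective J)
    (h : (((Matrix.of fun i j => V i (J j)).det : ℤ) : ZMod p) ≠ 0) : Function.Surjective (prL p V) := by
  let B : Matrix ι ι (ZMod p) := (Matrix.of fun i j => V i (J j)).map (Int.castRingHom (ZMod p))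
  have hB : B.det ≠ 0 := by
    have := (Int.castRingHom (ZMod p)).map_det (Matrix.of fun i j => V i (J j))
    rw [show B.det = ((Int.castRingHom (ZMod p)).mapMatrix (Matrix.of fun i j => V i (J j))).det from rfl, ← this]
    exact h
  have hBi : IsUnit B := (Matrix.isUnit_iff_isUnit_det _).2 hB.isUnit
  intro y
  obtain ⟨x, hx⟩ := (Matrix.mulVec_surjective_iff_isUnit.2 hBi) y
  refine ⟨Function.extend J x 0, ?_⟩
  rw [← hx]
  ext i
  rw [prL_apply]
  simp only [pr, Matrix.mulVec, dotProduct]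
  rw [← Finset.sum_subset (Finset.subset_univ (Finset.univ.map ⟨J, hJ⟩))]
  · rw [Finset.sum_map]
    refine Finset.sum_congr rfl fun j _ => ?_
    simp [hJ.extend_apply, B, mul_comm]
  · intro j _ hj
    rw [Function.extend_apply']
    · simp
    · rintro ⟨a, rfl⟩
      exact hj (by simp)

theorem surj_large [DecidableEq ι] (V : ι → Fin d → ℤ) (hV : LinearIndependent ℤ V) (b : ℝ) 
    (hb : ∀ i j, |(V i j : ℝ)| ≤ b) (hp : (Nat.factorial (Fintype.card ι)) * b ^ Fintype.card ι < (p:ℝ)) :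
    Function.Surjective (prL p V) := by
  obtain ⟨J, hJ, h0⟩ := exists_minor V hV
  refine surj_of_minor V J hJ fun h => h0 ?_
  rw [ZMod.intCast_zmod_eq_zero_iff_dvd] at h
  by_contra hne
  have h1 := Int.le_of_dvd (abs_pos.2 hne) ((dvd_abs _ _).2 h)
  have h2 : |((Matrix.of fun i j => V i (J j)).det : ℝ)| ≤ (Nat.factorial (Fintype.card ι)) * b ^ Fintype.card ι := by
    have := Matrix.det_le (A := (Matrix.of fun i j => (V i (J j) : ℝ))) (abv := IsAbsoluteValue.toAbsoluteValue (abs : ℝ → ℝ)) (x := b) (fun i j => hb i (J j))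
    have h3 : ((Matrix.of fun i j => V i (J j)).det : ℝ) = (Matrix.of fun i j => (V i (J j) : ℝ)).det := 
      (Int.castRingHom ℝ).map_det _
    rw [h3]
    simpa using this
  have h4 : (p:ℝ) ≤ |((Matrix.of fun i j => V i (J j)).det : ℝ)| := by exact_mod_cast h1
  linarith

end Count


section Mean
variable {d : ℕ} {ι : Type*} [Fintype ι]

/-- integer matrix acting on tuples -/
def iact (m : Matrix (Fin d) (Fin d) ℤ) (V : ι → Fin d → ℤ) : ι → Fin d → ℤ := fun i => m *ᵥ V i

theorem iact_inj (m : Matrix (Fin d) (Fin d) ℤ) (hm : m.det ≠ 0) :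
    Function.Injective (iact (ι := ι) m) := by
  intro a b hab
  ext1 i
  have := congrFun hab i
  exact Matrix.mulVec_injective_of_det_ne_zero hm this

def Stab (S : Set (ι → Fin d → ℤ)) : Prop :=
  ∀ m : Matrix (Fin d) (Fin d) ℤ, m.det ≠ 0 → ∀ V, iact m V ∈ S ↔ V ∈ S

theorem stab_univ : Stab (Set.univ : Set (ι → Fin d → ℤ)) := fun _ _ _ => by simp

def LI (d : ℕ) (ι : Type*) [Fintype ι] : Set (ι → Fin d → ℤ) := {V | LinearIndependent ℤ V}

theorem stab_LI : Stab (LI d ι) := by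
  intro m hm V
  have hk : LinearMap.ker (Matrix.mulVecLin m) = ⊥ := 
    LinearMap.ker_eq_bot.2 (Matrix.mulVec_injective_of_det_ne_zero hm)
  exact LinearMap.linearIndependent_iff (v := V) (Matrix.mulVecLin m) hk

def SF (S : Set (ι → Fin d → ℤ)) (A : Set (ι → Fin d → ℝ)) (g : SLR d) : ℝ≥0∞ :=
  ∑' V, S.indicator 1 V * A.indicator 1 (act g (cst V))

theorem meas_act (x : ι → Fin d → ℝ) : Measurable fun g : SLR d => act g x := by
  refine measurable_pi_lambda _ fun i => measurable_pi_lambda _ fun j => ?_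
  simp only [act_apply, Matrix.mulVec, dotProduct]
  exact Finset.measurable_sum _ fun a _ => (meas_entry j a).mul_const _

theorem meas_SF (S : Set (ι → Fin d → ℤ)) (A : Set (ι → Fin d → ℝ)) (hA : MeasurableSet A) : 
    Measurable (SF S A) := by
  unfold SF
  refine Measurable.tsum fun V => ?_
  exact ((measurable_one.indicator hA).comp (meas_act _)).const_mul _

theorem act_cst_iact (γ : SpecialLinearGroup (Fin d) ℤ) (V : ι → Fin d → ℤ) :
    act (Matrix.SpecialLinearGroup.map (n := Fin d) (Int.castRingHom ℝ) γ) (cst V) = cst (iact γ.1 V) := by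
  ext i j
  simp [act_apply, cst, iact, Matrix.mulVec, dotProduct]

theorem SF_inv (S : Set (ι → Fin d → ℤ)) (hS : Stab S) (A : Set (ι → Fin d → ℝ)) (g : SLR d) (γ : SLZ d) :
    SF S A (g * γ) = SF S A g := by
  obtain ⟨_, m, rfl⟩ := γ
  unfold SF
  have hdet : m.1.det ≠ 0 := by rw [m.2]; exact one_ne_zero
  have hbij : Function.Bijective (iact (ι := ι) m.1) := by
    refine ⟨iact_inj _ hdet, fun V => ⟨iact (m⁻¹).1 V, ?_⟩⟩
    ext1 i
    have : m.1 * (m⁻¹).1 = 1 := congrArg Subtype.val (mul_inv_cancel m)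
    simp only [iact, Matrix.mulVec_mulVec, this, Matrix.one_mulVec]
  conv_rhs => rw [← (Equiv.ofBijective _ hbij).tsum_eq]
  refine tsum_congr fun V => ?_
  change S.indicator 1 V * A.indicator 1 (act (g * (Matrix.SpecialLinearGroup.map (n := Fin d) (Int.castRingHom ℝ) m)) (cst V)) = S.indicator 1 (iact m.1 V) * A.indicator 1 (act g (cst (iact m.1 V)))
  rw [act_mul, act_cst_iact]
  congr 1
  classical
  simp only [Set.indicator_apply, hS m.1 hdet V, Pi.one_apply]

def SFX (S : Set (ι → Fin d → ℤ)) (hS : Stab S) (A : Set (ι → Fin d → ℝ)) : Xspace d → ℝ≥0∞ :=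
  Quotient.lift (SF S A) (by
    intro a b hab
    have h : a⁻¹ * b ∈ SLZ d := QuotientGroup.leftRel_apply.1 hab
    have hb : b = a * (⟨_, h⟩ : SLZ d) := by simp
    rw [hb, SF_inv S hS])

theorem SFX_mk (S : Set (ι → Fin d → ℤ)) (hS : Stab S) (A : Set (ι → Fin d → ℝ)) (g : SLR d) :
    SFX S hS A (QuotientGroup.mk g) = SF S A g := rfl

theorem meas_SFX (S : Set (ι → Fin d → ℤ)) (hS : Stab S) (A : Set (ι → Fin d → ℝ)) (hA : MeasurableSet A) : 
    Measurable (SFX S hS A) := meas_X _ (meas_SF S A hA)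

theorem hm_ne {p : ℕ} [Fact p.Prime] (l : NL d p) : (hm l).det ≠ 0 := by
  rw [hm_det]; exact_mod_cast (Fact.out : p.Prime).ne_zero

theorem SF_sl (p : ℕ) [Fact p.Prime] (S : Set (ι → Fin d → ℤ)) (hS : Stab S) (A : Set (ι → Fin d → ℝ)) 
    (g : SLR d) (l : NL d p) :
    SF S A (g * sl l) = ∑' V, (if ∀ i, pr l.1 (V i) = 0 then 1 else 0) * 
      (S.indicator 1 V * A.indicator 1 ((tt d p)⁻¹ • act g (cst V))) := by
  classical
  have hinj := iact_inj (ι := ι) _ (hm_ne l)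
  have hr : ∀ V : ι → Fin d → ℤ, (∀ i, pr l.1 (V i) = 0) ↔ V ∈ Set.range (iact (ι := ι) (hm l)) := by
    intro V
    simp only [hm_iff]
    constructor
    · intro h
      choose w hw using h
      exact ⟨w, funext hw⟩
    · rintro ⟨w, rfl⟩ i
      exact ⟨w i, rfl⟩
  rw [← hinj.tsum_eq]
  · unfold SF
    refine tsum_congr fun W => ?_
    rw [if_pos ((hr _).2 ⟨W, rfl⟩), one_mul]
    congr 1
    · simp only [Set.indicator_apply, hS _ (hm_ne l) W, Pi.one_apply]
    · congr 1
      rw [act_mul, ← map_smul]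
      congr 1
      ext i j
      simp [act_apply, sl_coe, cst, iact, Matrix.mulVec, dotProduct, Finset.mul_sum, mul_assoc]
  · intro V hV
    rw [← hr]
    by_contra h
    exact hV (by simp [h])

theorem hecke_sum (p : ℕ) [Fact p.Prime] (S : Set (ι → Fin d → ℤ)) (hS : Stab S) (A : Set (ι → Fin d → ℝ)) 
    (g : SLR d) : ∑ l : NL d p, SF S A (g * sl l) = 
      ∑' V, (cnt p V : ℝ≥0∞) * (S.indicator 1 V * A.indicator 1 ((tt d p)⁻¹ • act g (cst V))) := by
  classical
  simp only [SF_sl p S hS A g]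
  rw [← Summable.tsum_finsetSum (fun _ _ => ENNReal.summable)]
  refine tsum_congr fun V => ?_
  rw [← Finset.sum_mul]
  congr 1
  rw [Finset.sum_boole]
  congr 1
  unfold cnt
  rw [Fintype.card_subtype]

theorem one_le_tt {p : ℕ} (hp : p.Prime) : 1 ≤ tt d p := 
  Real.one_le_rpow (by exact_mod_cast hp.one_le) (by positivity)

theorem primes_seq (hd : d ≠ 0) : ∃ P : ℕ → ℕ, (∀ n, (P n).Prime) ∧ Tendsto (fun n => tt d (P n)) atTop atTop := by
  choose P hP using Nat.exists_infinite_primes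
  refine ⟨P, fun n => (hP n).2, ?_⟩
  have h1 : Tendsto (fun n => (P n : ℝ)) atTop atTop := 
    tendsto_atTop_mono (fun n => by exact_mod_cast (hP n).1) tendsto_natCast_atTop_atTop
  exact (tendsto_rpow_atTop (by positivity)).comp h1


theorem scal_up (p : ℕ) [Fact p.Prime] (h : Fintype.card ι < d) (c : ℕ)
    (hc : c + 1 = p ^ (d - Fintype.card ι)) :
    (Fintype.card (NL d p) : ℝ≥0∞)⁻¹ * c ≤ ENNReal.ofReal (tt d p ^ (d * Fintype.card ι))⁻¹ := by
  have hp := (Fact.out : p.Prime)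
  have hd : d ≠ 0 := by omega
  have hN1 : 1 < p ^ d := Nat.one_lt_pow hd hp.one_lt
  rw [pow_mul, tt_pow hd, card_NL]
  have hN : 0 < p ^ d - 1 := Nat.sub_pos_of_lt hN1
  have e1 : ((p ^ d - 1 : ℕ) : ℝ≥0∞)⁻¹ * c = ENNReal.ofReal (((p ^ d - 1 : ℕ) : ℝ)⁻¹ * c) := by
    rw [ENNReal.ofReal_mul (by positivity), ENNReal.ofReal_inv_of_pos (by exact_mod_cast hN),
      ENNReal.ofReal_natCast, ENNReal.ofReal_natCast]
  rw [e1]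
  apply ENNReal.ofReal_le_ofReal
  have hpr : (0:ℝ) < p := by exact_mod_cast hp.pos
  have hNr : (0:ℝ) < ((p ^ d - 1 : ℕ) : ℝ) := by exact_mod_cast hN
  rw [inv_mul_le_iff₀ hNr, ← div_eq_mul_inv, le_div_iff₀ (by positivity)]
  have h1 : (p:ℝ) ^ d = p ^ (d - Fintype.card ι) * p ^ Fintype.card ι := by
    rw [← pow_add, Nat.sub_add_cancel h.le]
  have h2 : (c:ℝ) + 1 = p ^ (d - Fintype.card ι) := by exact_mod_cast hc
  rw [Nat.cast_sub hN1.le, Nat.cast_pow, Nat.cast_one, h1, ← h2]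
  have h3 : (1:ℝ) ≤ (p:ℝ) ^ Fintype.card ι := one_le_pow₀ (by exact_mod_cast hp.one_le)
  nlinarith

theorem scal_low (p : ℕ) [Fact p.Prime] (h : Fintype.card ι < d) (c : ℕ)
    (hc : p ^ (d - Fintype.card ι) ≤ c + 1) :
    ENNReal.ofReal (1 - (p:ℝ)⁻¹) * ENNReal.ofReal (tt d p ^ (d * Fintype.card ι))⁻¹ ≤ 
      (Fintype.card (NL d p) : ℝ≥0∞)⁻¹ * c := by
  have hp := (Fact.out : p.Prime)
  have hd : d ≠ 0 := by omega
  have hN1 : 1 < p ^ d := Nat.one_lt_pow hd hp.one_lt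
  rw [pow_mul, tt_pow hd, card_NL]
  have hN : 0 < p ^ d - 1 := Nat.sub_pos_of_lt hN1
  have e1 : ((p ^ d - 1 : ℕ) : ℝ≥0∞)⁻¹ * c = ENNReal.ofReal (((p ^ d - 1 : ℕ) : ℝ)⁻¹ * c) := by
    rw [ENNReal.ofReal_mul (by positivity), ENNReal.ofReal_inv_of_pos (by exact_mod_cast hN),
      ENNReal.ofReal_natCast, ENNReal.ofReal_natCast]
  have hpr : (0:ℝ) < p := by exact_mod_cast hp.pos
  have hp1 : (1:ℝ) ≤ p := by exact_mod_cast hp.one_le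
  have hNr : (0:ℝ) < ((p ^ d - 1 : ℕ) : ℝ) := by exact_mod_cast hN
  have hq : 0 ≤ 1 - (p:ℝ)⁻¹ := by linarith [inv_le_one_of_one_le₀ hp1]
  rw [e1, ← ENNReal.ofReal_mul hq]
  apply ENNReal.ofReal_le_ofReal
  rw [← div_eq_inv_mul, ← div_eq_mul_inv, div_le_div_iff₀ (by positivity) hNr]
  have h1 : (p:ℝ) ^ d = p ^ (d - Fintype.card ι) * p ^ Fintype.card ι := by
    rw [← pow_add, Nat.sub_add_cancel h.le]
  have h2 : (p:ℝ) ^ (d - Fintype.card ι) ≤ (c:ℝ) + 1 := by exact_mod_cast hc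
  have h3 : (0:ℝ) < (p:ℝ) ^ Fintype.card ι := by positivity
  have h4 : (p:ℝ) ^ Fintype.card ι ≤ (p:ℝ)⁻¹ * p ^ d := by
    have : (p:ℝ)⁻¹ * p ^ d = p ^ (d - 1) := by
      obtain ⟨e, rfl⟩ := Nat.exists_eq_succ_of_ne_zero hd
      rw [pow_succ]; field_simp; simp
    rw [this]
    exact pow_le_pow_right₀ hp1 (by omega)
  rw [Nat.cast_sub hN1.le, Nat.cast_pow, Nat.cast_one]
  have h5 : (p:ℝ) ^ d ≤ (c + 1) * p ^ Fintype.card ι := by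
    rw [h1]; exact mul_le_mul_of_nonneg_right h2 h3.le
  nlinarith

theorem meanL (μ : Measure (Xspace d)) [IsProbabilityMeasure μ]
    (hμ : ∀ γ : SLR d, Measure.map (fun x => γ • x) μ = μ) (h : Fintype.card ι < d)
    (A : Set (ι → Fin d → ℝ)) (hA : IsOpen A) : volume A ≤ ∫⁻ x, SFX Set.univ stab_univ A x ∂μ := by
  have hd : d ≠ 0 := by omega
  obtain ⟨P, hP, htt⟩ := primes_seq hd
  have hF : ∀ n, Fact (P n).Prime := fun n => ⟨hP n⟩
  have hmF := meas_SFX Set.univ stab_univ A hA.measurableSet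
  have hm : ∀ n, Measurable fun x => (Fintype.card (NL d (P n)) : ℝ≥0∞)⁻¹ * ∫⁻ y, SFX Set.univ stab_univ A y ∂(heck d (P n) x) :=
    fun n => ((Measure.measurable_lintegral hmF).comp meas_heck).const_mul _
  have h1 := lintegral_liminf_le (μ := μ) (u := atTop) hm
  simp only [← fun n => hecke_inv (p := P n) hd μ hμ _ hmF] at h1
  rw [liminf_const] at h1
  refine le_trans ?_ h1
  have h2 : ∫⁻ _, volume A ∂μ = volume A := by simp
  rw [← h2]
  refine lintegral_mono fun x => ?_
  induction x using QuotientGroup.induction_on with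
  | H g =>
  simp only [fun n => lint_heck (p := P n) g _ hmF, SFX_mk, hecke_sum _ _ stab_univ]
  have h3 := RS_lower g A hA (fun n => tt d (P n)) (fun n => one_le_tt (hP n)) htt
  have h4 : liminf (fun n => ENNReal.ofReal (1 - (P n : ℝ)⁻¹)) atTop = 1 := by
    apply Tendsto.liminf_eq
    have h5 : Tendsto (fun n => (P n : ℝ)) atTop atTop := by
      have := (tendsto_pow_atTop hd).comp htt
      simpa [Function.comp_def, tt_pow hd] using this
    have h6 := (tendsto_inv_atTop_zero.comp h5).const_sub 1
    have h7 := ENNReal.tendsto_ofReal h6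
    simpa [Function.comp_def] using h7
  have h5 := ENNReal.le_liminf_mul (f := atTop) (u := fun n => ENNReal.ofReal (1 - (P n : ℝ)⁻¹)) (v := fun n => RS g A (tt d (P n)))
  rw [h4, one_mul] at h5
  refine (h3.trans h5).trans (liminf_le_liminf (Eventually.of_forall fun n => ?_))
  simp only [Pi.mul_apply, RS]
  rw [← ENNReal.tsum_mul_left, ← ENNReal.tsum_mul_left, ← ENNReal.tsum_mul_left]
  refine ENNReal.tsum_le_tsum fun V => ?_
  rw [← mul_assoc, ← mul_assoc, ← mul_assoc]
  simp only [Set.indicator_univ, Pi.one_apply, mul_one]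
  exact mul_le_mul' (scal_low (P n) h _ (cnt_ge V h.le)) le_rfl

theorem meanU (μ : Measure (Xspace d)) [IsProbabilityMeasure μ]
    (hμ : ∀ γ : SLR d, Measure.map (fun x => γ • x) μ = μ) (h : Fintype.card ι < d)
    (A : Set (ι → Fin d → ℝ)) (hA : IsCompact A) : ∫⁻ x, SFX (LI d ι) stab_LI A x ∂μ ≤ volume A := by
  classical
  have hd : d ≠ 0 := by omega
  obtain ⟨P, hP, htt⟩ := primes_seq hd
  have hF : ∀ n, Fact (P n).Prime := fun n => ⟨hP n⟩
  have hmF := meas_SFX (LI d ι) stab_LI A hA.measurableSet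
  have hsup : ∀ x, SFX (LI d ι) stab_LI A x = ⨆ M : ℕ, SFX (LI d ι) stab_LI A x ⊓ M := by
    intro x
    rw [← inf_iSup_eq, ENNReal.iSup_natCast, inf_top_eq]
  have hmM : ∀ M : ℕ, Measurable fun x => SFX (LI d ι) stab_LI A x ⊓ (M : ℝ≥0∞) := fun M =>
    hmF.inf measurable_const
  rw [lintegral_congr hsup, lintegral_iSup hmM]
  swap
  · intro a b hab x
    exact inf_le_inf_left _ (by exact_mod_cast hab)
  refine iSup_le fun M => ?_
  have hm : ∀ n, Measurable fun x => (Fintype.card (NL d (P n)) : ℝ≥0∞)⁻¹ * 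
      ∫⁻ y, SFX (LI d ι) stab_LI A y ⊓ (M : ℝ≥0∞) ∂(heck d (P n) x) :=
    fun n => ((Measure.measurable_lintegral (hmM M)).comp meas_heck).const_mul _
  have h1 := limsup_lintegral_le (μ := μ) (fun _ => (M : ℝ≥0∞)) hm (fun n => ae_of_all _ fun x => ?_) (by simp)
  · simp only [← fun n => hecke_inv (p := P n) hd μ hμ _ (hmM M)] at h1
    rw [limsup_const] at h1
    refine h1.trans ?_
    have h2 : ∫⁻ _, volume A ∂μ = volume A := by simp
    rw [← h2]
    refine lintegral_mono fun x => ?_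
    induction x using QuotientGroup.induction_on with
    | H g =>
    simp only [fun n => lint_heck (p := P n) g _ (hmM M), SFX_mk]
    have h3 := RS_upper g A hA (fun n => tt d (P n)) (fun n => one_le_tt (hP n)) htt
    refine le_trans (limsup_le_limsup ?_) h3
    obtain ⟨c, hc, hb⟩ := act_bound (ι := ι) g
    obtain ⟨R, hR⟩ := hA.isBounded.exists_norm_le
    set r := Fintype.card ι with hr
    have hev : ∀ᶠ n in atTop, (r.factorial : ℝ) * (c * R) ^ r < tt d (P n) ^ (d - r) := 
      ((tendsto_pow_atTop (by omega)).comp htt).eventually_gt_atTop _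
    filter_upwards [hev] with n hn
    have htp := tt_pos (d := d) (hP n)
    calc _ ≤ (Fintype.card (NL d (P n)) : ℝ≥0∞)⁻¹ * ∑ l : NL d (P n), SF (LI d ι) A (g * sl l) := by
          gcongr
          exact inf_le_left
      _ ≤ _ := by
          rw [hecke_sum _ _ stab_LI]
          unfold RS
          rw [← ENNReal.tsum_mul_left, ← ENNReal.tsum_mul_left]
          refine ENNReal.tsum_le_tsum fun V => ?_
          by_cases hV : V ∈ LI d ι
          · by_cases hVA : (tt d (P n))⁻¹ • act g (cst V) ∈ A
            · rw [Set.indicator_of_mem hV, Pi.one_apply, one_mul, ← mul_assoc]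
              gcongr
              refine scal_up (P n) h _ (cnt_eq V h.le ?_)
              refine surj_large V hV (tt d (P n) * (c * R)) (fun i j => ?_) ?_
              · have h5 : ‖act g (cst V)‖ ≤ tt d (P n) * R := by
                  have := hR _ hVA
                  rwa [norm_smul, norm_inv, Real.norm_of_nonneg htp.le, inv_mul_le_iff₀ htp] at this
                have h6 := (hb (cst V)).trans (mul_le_mul_of_nonneg_left h5 hc.le)
                have h7 := (norm_le_pi_norm (cst V i) j).trans ((norm_le_pi_norm (cst V) i).trans h6)
                calc |(V i j : ℝ)| ≤ _ := h7
                  _ = _ := by ring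
              · rw [← tt_pow (d := d) (p := P n) hd, mul_pow]
                calc _ = ((r.factorial : ℝ) * (c * R) ^ r) * tt d (P n) ^ r := by ring
                  _ < tt d (P n) ^ (d - r) * tt d (P n) ^ r := mul_lt_mul_of_pos_right hn (pow_pos htp _)
                  _ = _ := by rw [← pow_add, Nat.sub_add_cancel h.le]
            · simp [Set.indicator_of_notMem hVA]
          · simp [Set.indicator_of_notMem hV]
  · induction x using QuotientGroup.induction_on with
    | H g =>
    simp only [fun n => lint_heck (p := P n) g _ (hmM M), SFX_mk]
    calc _ ≤ (Fintype.card (NL d (P n)) : ℝ≥0∞)⁻¹ * ∑ l : NL d (P n), (M : ℝ≥0∞) := by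
          gcongr
          exact inf_le_right
      _ ≤ M := by
          rw [Finset.sum_const, nsmul_eq_mul, ← mul_assoc, Finset.card_univ]
          exact mul_le_of_le_one_left zero_le (ENNReal.inv_mul_le_one _)

end Mean


section LinAlg

theorem repr_det {r : ℕ} {U : Type*} [AddCommGroup U] [Module ℚ U] (b b' : Module.Basis (Fin r) ℚ U)
    (a : Fin r) (x : U) : b.det (Function.update b' a x) = b'.repr x a * b.det b' := by
  have h1 := b.det.eq_smul_basis_det b'
  have h2 : b.det (Function.update b' a x) = b.det b' * b'.det (Function.update b' a x) := by
    conv_lhs => rw [h1]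
    simp
  rw [h2, mul_comm]
  congr 1
  rw [Module.Basis.det_apply, Module.Basis.toMatrix_update, Module.Basis.toMatrix_self,
    ← Matrix.cramer_apply, Matrix.cramer_one]
  simp

theorem good_basis {K W : Type*} [Fintype K] [DecidableEq K] [AddCommGroup W] [Module ℚ W] (v : K → W) :
    ∃ s : Finset K, LinearIndependent ℚ (fun a : s => v a) ∧ ∃ C : K → s → ℚ, (∀ κ a, |C κ a| ≤ 1) ∧
      (∀ κ, v κ = ∑ a : s, C κ a • v a) := by
  classical
  let U := Submodule.span ℚ (Set.range v)
  have hfd : FiniteDimensional ℚ U := FiniteDimensional.span_of_finite ℚ (Set.finite_range v)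
  let u : K → U := fun κ => ⟨v κ, Submodule.subset_span ⟨κ, rfl⟩⟩
  have huv : ∀ κ, (u κ : W) = v κ := fun _ => rfl
  let b : Module.Basis (Fin (Module.finrank ℚ U)) ℚ U := Module.finBasis ℚ U
  obtain ⟨κ, a, ha, hsp, hli⟩ := exists_linearIndependent' ℚ u
  have hκ : Fintype κ := Fintype.ofInjective a ha
  have hsu : Submodule.span ℚ (Set.range u) = ⊤ := by
    have h1 : Submodule.map U.subtype (Submodule.span ℚ (Set.range u)) = Submodule.map U.subtype ⊤ := by
      rw [Submodule.map_span, Submodule.map_top, Submodule.range_subtype, ← Set.range_comp]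
      rfl
    exact Submodule.map_injective_of_injective U.injective_subtype h1
  let b0 : Module.Basis κ ℚ U := Module.Basis.mk hli (by rw [hsp, hsu])
  have hc : Fintype.card κ = Module.finrank ℚ U := (Module.finrank_eq_card_basis b0).symm
  let e : Fin (Module.finrank ℚ U) ≃ κ := (Fintype.equivFinOfCardEq hc).symm
  have hne : Nonempty (Fin (Module.finrank ℚ U) → K) := ⟨a ∘ e⟩
  obtain ⟨J, hJ⟩ := Finite.exists_max (fun J : Fin (Module.finrank ℚ U) → K => |b.det (u ∘ J)|)
  have hJ0 : b.det (u ∘ J) ≠ 0 := by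
    have h1 := hJ (a ∘ e)
    have h2 : b.det (u ∘ (a ∘ e)) ≠ 0 := by
      have h3 : u ∘ (a ∘ e) = (b0.reindex e.symm : _ → U) := by
        ext1 i
        simp [b0]
      rw [h3]
      exact (b.isUnit_det _).ne_zero
    have h3 : 0 < |b.det (u ∘ (a ∘ e))| := abs_pos.2 h2
    exact abs_pos.1 (h3.trans_le h1)
  have hJb := (b.is_basis_iff_det (v := u ∘ J)).2 hJ0.isUnit
  let b' : Module.Basis (Fin (Module.finrank ℚ U)) ℚ U := Module.Basis.mk hJb.1 hJb.2.ge
  have hb' : (b' : _ → U) = u ∘ J := Module.Basis.coe_mk _ _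
  have hJi : Function.Injective J := by
    intro x y hxy
    apply hJb.1.injective
    simp [hxy]
  have hC : ∀ κ a, |b'.repr (u κ) a| ≤ 1 := by
    intro κ a
    have h1 := repr_det b b' a (u κ)
    rw [hb', ← Function.comp_update] at h1
    have h2 := hJ (Function.update J a κ)
    simp only [h1, abs_mul] at h2
    exact le_of_mul_le_mul_right (by rwa [one_mul]) (abs_pos.2 hJ0)
  let s : Finset K := Finset.univ.map ⟨J, hJi⟩
  let f : Fin (Module.finrank ℚ U) ≃ s := Equiv.ofBijective (fun i => ⟨J i, by simp [s]⟩)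
    ⟨fun x y h => hJi (congrArg Subtype.val h), fun ⟨y, hy⟩ => by
      simp only [s, Finset.mem_map, Finset.mem_univ, true_and] at hy
      obtain ⟨i, hi⟩ := hy
      exact ⟨i, Subtype.ext hi⟩⟩
  have hf : ∀ i, (f i : K) = J i := fun _ => rfl
  refine ⟨s, ?_, fun κ a => b'.repr (u κ) (f.symm a), fun κ a => hC _ _, fun κ => ?_⟩
  · have h1 : LinearIndependent ℚ (fun i => v (J i)) := by
      have := hJb.1.map' U.subtype U.ker_subtype
      exact this
    rw [← linearIndependent_equiv f]
    exact h1
  · rw [← f.sum_comp]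
    simp only [Equiv.symm_apply_apply, hf]
    have := congrArg (U.subtype) (b'.sum_repr (u κ))
    rw [map_sum] at this
    simp only [map_smul, hb'] at this
    exact this.symm

/-- casting tuples to the rationals -/
def qst {ι : Type*} {d : ℕ} (V : ι → Fin d → ℤ) : ι → Fin d → ℚ := fun i j => (V i j : ℚ)

theorem li_cast {ι : Type*} {d : ℕ} (V : ι → Fin d → ℤ) : LinearIndependent ℤ V ↔ LinearIndependent ℚ (qst V) := by
  rw [← LinearIndependent.iff_fractionRing (R := ℤ) (K := ℚ)]
  let f : (Fin d → ℤ) →ₗ[ℤ] (Fin d → ℚ) := LinearMap.pi fun j => 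
    (Int.castAddHom ℚ).toIntLinearMap ∘ₗ LinearMap.proj j
  have hf : qst V = f ∘ V := rfl
  rw [hf]
  refine (LinearMap.linearIndependent_iff f ?_).symm
  rw [LinearMap.ker_eq_bot]
  intro a b hab
  ext j
  have := congrFun hab j
  simpa [f] using this

/-- the denominator lattice -/
def Lam {K ι : Type*} [Fintype ι] (C : K → ι → ℚ) : Submodule ℤ (ι → ℤ) where
  carrier := {w | ∀ κ, ∃ n : ℤ, ∑ a, C κ a * (w a : ℚ) = n}
  zero_mem' := fun κ => ⟨0, by simp⟩
  add_mem' := by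
    intro x y hx hy κ
    obtain ⟨m, hm⟩ := hx κ
    obtain ⟨n, hn⟩ := hy κ
    refine ⟨m + n, ?_⟩
    push_cast
    rw [← hm, ← hn, ← Finset.sum_add_distrib]
    refine Finset.sum_congr rfl fun a _ => ?_
    simp; ring
  smul_mem' := by
    intro c x hx κ
    obtain ⟨m, hm⟩ := hx κ
    refine ⟨c * m, ?_⟩
    push_cast
    rw [← hm, Finset.mul_sum]
    refine Finset.sum_congr rfl fun a _ => ?_
    simp; ring

theorem exists_P {K ι : Type*} [Fintype ι] [DecidableEq ι] [Fintype K] (C : K → ι → ℚ) :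
    ∃ P : Matrix ι ι ℤ, P.det ≠ 0 ∧ (∀ b, P b ∈ Lam C) ∧ 
      ∀ w ∈ Lam C, ∃ x : ι → ℤ, w = ∑ b, x b • P b := by
  classical
  -- common denominator
  let q : ℤ := ∏ κ, ∏ a, ((C κ a).den : ℤ)
  have hq : q ≠ 0 := Finset.prod_ne_zero_iff.2 fun κ _ => Finset.prod_ne_zero_iff.2 fun a _ => by simp
  have hqC : ∀ κ a, ∃ n : ℤ, C κ a * q = n := by
    intro κ a
    have h1 : ((C κ a).den : ℤ) ∣ q := 
      (Finset.dvd_prod_of_mem (fun a => ((C κ a).den : ℤ)) (Finset.mem_univ a)).trans 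
        (Finset.dvd_prod_of_mem (fun κ => ∏ a, ((C κ a).den : ℤ)) (Finset.mem_univ κ))
    obtain ⟨m, hm⟩ := h1
    refine ⟨(C κ a).num * m, ?_⟩
    rw [hm]; push_cast
    rw [← mul_assoc, Rat.mul_den_eq_num]
  have hqL : ∀ w : ι → ℤ, q • w ∈ Lam C := by
    intro w κ
    choose n hn using hqC κ
    refine ⟨∑ a, n a * w a, ?_⟩
    push_cast
    refine Finset.sum_congr rfl fun a _ => ?_
    rw [← hn]; simp; ring
  have hrank : Module.finrank ℤ (Lam C) = Module.finrank ℤ (ι → ℤ) := by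
    apply le_antisymm (Submodule.finrank_le _)
    let f : (ι → ℤ) →ₗ[ℤ] Lam C := LinearMap.codRestrict _ (LinearMap.lsmul ℤ (ι → ℤ) q) hqL
    apply LinearMap.finrank_le_finrank_of_injective (f := f)
    intro x y hxy
    have := congrArg Subtype.val hxy
    simp only [f] at this
    exact smul_right_injective _ hq this
  have hcard : Module.finrank ℤ (Lam C) = Fintype.card ι := by rw [hrank]; simp
  let B0 := Module.finBasisOfFinrankEq ℤ (Lam C) hcard
  let B : Module.Basis ι ℤ (Lam C) := B0.reindex (Fintype.equivFin ι).symm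
  refine ⟨Matrix.of fun b => (B b : ι → ℤ), ?_, fun b => (B b).2, fun w hw => ⟨fun b => B.repr ⟨w, hw⟩ b, ?_⟩⟩
  · refine Matrix.nonsingular_iff_det_ne_zero.1 (Matrix.Nonsingular.of_linearIndependent_row ?_)
    exact B.linearIndependent.map' (Lam C).subtype (Lam C).ker_subtype
  · have := congrArg (Lam C).subtype (B.sum_repr ⟨w, hw⟩)
    rw [map_sum] at this
    simp only [map_smul] at this
    exact this.symm

end LinAlg


section Cfs
variable {K : Type*} [Fintype K] [DecidableEq K]

def Cf (K : Type*) [Fintype K] [DecidableEq K] (s : Finset K) : Type _ :=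
  {C : K → s → ℚ // (∀ κ a, |C κ a| ≤ 1) ∧ ∀ a b : s, C a b = if a = b then 1 else 0}

instance (s : Finset K) : Countable (Cf K s) := by unfold Cf; infer_instance

def PM {s : Finset K} (C : Cf K s) : Matrix s s ℤ := (exists_P C.1).choose
theorem PM_det {s : Finset K} (C : Cf K s) : (PM C).det ≠ 0 := (exists_P C.1).choose_spec.1
theorem PM_mem {s : Finset K} (C : Cf K s) (b : s) : PM C b ∈ Lam C.1 := (exists_P C.1).choose_spec.2.1 b
theorem PM_span {s : Finset K} (C : Cf K s) (w : s → ℤ) (hw : w ∈ Lam C.1) : 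
  ∃ x : s → ℤ, w = ∑ b, x b • PM C b := (exists_P C.1).choose_spec.2.2 w hw

def DD {s : Finset K} (C : Cf K s) : ℕ := (PM C).det.natAbs

theorem DC_int {s : Finset K} (C : Cf K s) (κ : K) (a : s) : ∃ n : ℤ, (DD C : ℚ) * C.1 κ a = n := by
  choose n hn using fun b => PM_mem C b κ
  let Q : Matrix s s ℚ := (PM C).map (Int.castRingHom ℚ)
  have h1 : Q *ᵥ (C.1 κ) = fun b => (n b : ℚ) := by
    ext b
    rw [← hn]
    simp [Q, Matrix.mulVec, dotProduct, mul_comm]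
  have h2 : Q.det • C.1 κ = Q.adjugate *ᵥ (fun b => (n b : ℚ)) := by
    rw [← h1, Matrix.mulVec_mulVec, Matrix.adjugate_mul, Matrix.smul_mulVec, Matrix.one_mulVec]
  have h3 : Q.det = ((PM C).det : ℚ) := ((Int.castRingHom ℚ).map_det (PM C)).symm
  have h4 : Q.adjugate = (PM C).adjugate.map (Int.castRingHom ℚ) := 
    ((Int.castRingHom ℚ).map_adjugate (PM C)).symm
  have h5 : ((PM C).det : ℚ) * C.1 κ a = ((∑ b, (PM C).adjugate a b * n b : ℤ) : ℚ) := by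
    have := congrFun h2 a
    rw [h3, h4] at this
    simpa [Matrix.mulVec, dotProduct] using this
  have h6 : (DD C : ℚ) = |((PM C).det : ℚ)| := by
    unfold DD
    rw [← Int.cast_natCast, Int.natCast_natAbs, Int.cast_abs]
  rcases abs_choice ((PM C).det : ℚ) with h | h
  · exact ⟨_, by rw [h6, h, h5]⟩
  · exact ⟨-(∑ b, (PM C).adjugate a b * n b : ℤ), by rw [h6, h, neg_mul, h5]; push_cast; rfl⟩

theorem DD_pos {s : Finset K} (C : Cf K s) : 0 < DD C := Int.natAbs_pos.2 (PM_det C)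

def enc {s : Finset K} (C : Cf K s) : 
    Σ D : ℕ, ({κ // κ ∉ s} → s → Set.Icc (-(D:ℤ)) D) :=
  ⟨DD C, fun κ a => ⟨(DC_int C κ a).choose, by
    have h := (DC_int C κ.1 a).choose_spec
    have h1 := C.2.1 κ.1 a
    have h2 : |((DC_int C κ.1 a).choose : ℚ)| ≤ DD C := by
      rw [← h, abs_mul, Nat.abs_cast]
      exact mul_le_of_le_one_right (by positivity) h1
    have h3 : |(DC_int C κ.1 a).choose| ≤ (DD C : ℤ) := by exact_mod_cast h2
    exact abs_le.1 h3⟩⟩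

theorem enc_inj {s : Finset K} : Function.Injective (enc (s := s)) := by
  intro C C' h
  have hD : DD C = DD C' := congrArg Sigma.fst h
  have h2 : ∀ (x y : Σ D : ℕ, ({κ // κ ∉ s} → s → Set.Icc (-(D:ℤ)) D)), x = y → ∀ κ a, (x.2 κ a : ℤ) = y.2 κ a := by
    rintro x _ rfl κ a; rfl
  have h3 := h2 _ _ h
  apply Subtype.ext
  ext κ a
  by_cases hκ : κ ∈ s
  · have e1 := C.2.2 ⟨κ, hκ⟩ a
    have e2 := C'.2.2 ⟨κ, hκ⟩ a
    exact e1.trans e2.symm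
  · have e := h3 ⟨κ, hκ⟩ a
    have e1 := (DC_int C κ a).choose_spec
    have e2 := (DC_int C' κ a).choose_spec
    have e3 : (DD C : ℚ) * C.1 κ a = DD C * C'.1 κ a := by
      rw [e1]
      conv_rhs => rw [hD]
      rw [e2]
      exact_mod_cast e
    exact mul_left_cancel₀ (by exact_mod_cast (DD_pos C).ne') e3

theorem sum_fin (d : ℕ) (s : Finset K) (hd : (Fintype.card K - s.card) * s.card + 2 ≤ d) :
    ∑' C : Cf K s, ENNReal.ofReal ((DD C : ℝ) ^ d)⁻¹ ≠ ∞ := by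
  set m := (Fintype.card K - s.card) * s.card with hm
  let w : (Σ D : ℕ, ({κ // κ ∉ s} → s → Set.Icc (-(D:ℤ)) D)) → ℝ≥0∞ := fun x => 
    ENNReal.ofReal ((x.1 : ℝ) ^ d)⁻¹
  have h1 : ∑' C : Cf K s, ENNReal.ofReal ((DD C : ℝ) ^ d)⁻¹ ≤ ∑' x, w x :=
    ENNReal.tsum_comp_le_tsum_of_injective enc_inj w
  refine ne_top_of_le_ne_top ?_ h1
  rw [ENNReal.tsum_sigma' w]
  have h2 : ∀ D : ℕ, ∑' y : ({κ // κ ∉ s} → s → Set.Icc (-(D:ℤ)) D), w ⟨D, y⟩ ≤ 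
      ENNReal.ofReal (3 ^ m * ((D:ℝ) ^ 2)⁻¹) := by
    intro D
    simp only [w]
    rw [tsum_fintype, Finset.sum_const, nsmul_eq_mul, ← ENNReal.ofReal_natCast, ← ENNReal.ofReal_mul (by positivity)]
    apply ENNReal.ofReal_le_ofReal
    have hc : (Finset.univ : Finset ({κ // κ ∉ s} → s → Set.Icc (-(D:ℤ)) D)).card = (2 * D + 1) ^ m := by
      rw [Finset.card_univ, Fintype.card_fun, Fintype.card_fun]
      rw [← pow_mul, hm]
      congr 1
      · simp; omega
      · rw [Fintype.card_subtype_compl]; simp [mul_comm]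
    rw [hc]
    rcases Nat.eq_zero_or_pos D with rfl | hD
    · have : d ≠ 0 := by omega
      simp [this]
    have hD1 : (1:ℝ) ≤ D := by exact_mod_cast hD
    have hD0 : (0:ℝ) < D := by linarith
    push_cast
    have e1 : (2 * (D:ℝ) + 1) ^ m ≤ 3 ^ m * D ^ m := by
      rw [← mul_pow]
      exact pow_le_pow_left₀ (by positivity) (by linarith) _
    have e2 : (D:ℝ) ^ m * D ^ 2 ≤ D ^ d := by
      rw [← pow_add]
      exact pow_le_pow_right₀ hD1 hd
    rw [← div_eq_mul_inv, ← div_eq_mul_inv, div_le_div_iff₀ (by positivity) (by positivity)]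
    calc _ ≤ 3 ^ m * (D:ℝ) ^ m * D ^ 2 := by gcongr
      _ = 3 ^ m * ((D:ℝ) ^ m * D ^ 2) := by ring
      _ ≤ _ := by gcongr
  refine ne_top_of_le_ne_top ?_ (ENNReal.tsum_le_tsum h2)
  have h3 : Summable fun D : ℕ => 3 ^ m * ((D:ℝ) ^ 2)⁻¹ := 
    (Real.summable_nat_pow_inv.2 (by norm_num)).mul_left _
  exact h3.tsum_ofReal_ne_top

theorem decomp {d : ℕ} (M : K → Fin d → ℤ) : ∃ s : Finset K, ∃ C : Cf K s, ∃ W : s → Fin d → ℤ,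
    W ∈ LI d s ∧ (∀ a : s, M a = ∑ b, PM C b a • W b) ∧ (∀ κ, qst M κ = ∑ a : s, C.1 κ a • qst M a) ∧
    (M ≠ 0 → s.Nonempty) ∧ (M ∉ LI d K → s ≠ Finset.univ) := by
  obtain ⟨s, hli, C, hC, hs⟩ := good_basis (qst M)
  have hid : ∀ a b : s, C a b = if a = b then 1 else 0 := by
    intro a b
    have h1 := hs a
    have h2 : qst M a = ∑ b : s, (if a = b then (1:ℚ) else 0) • qst M b := by simp
    have h3 : ∑ b : s, (C a b - if a = b then (1:ℚ) else 0) • qst M b = 0 := by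
      simp only [sub_smul, Finset.sum_sub_distrib]
      rw [← h1, ← h2, sub_self]
    have := Fintype.linearIndependent_iff.1 hli _ h3 b
    linarith
  let C' : Cf K s := ⟨C, hC, hid⟩
  have hmem : ∀ j, (fun a : s => M a j) ∈ Lam C'.1 := by
    intro j κ
    refine ⟨M κ j, ?_⟩
    have := congrFun (hs κ) j
    simp only [qst, Finset.sum_apply, Pi.smul_apply, smul_eq_mul] at this
    exact this.symm
  choose x hx using fun j => PM_span C' _ (hmem j)
  have hM : ∀ a : s, M a = ∑ b, PM C' b a • (fun j => x j b) := by
    intro a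
    ext j
    have := congrFun (hx j) a
    simpa [mul_comm] using this
  refine ⟨s, C', fun b j => x j b, ?_, hM, hs, ?_, ?_⟩
  · change LinearIndependent ℤ _
    rw [li_cast, linearIndependent_iff_card_le_finrank_span]
    have h1 := finrank_span_eq_card hli
    rw [← h1]
    have hle : Submodule.span ℚ (Set.range fun a : s => qst M a) ≤ 
        Submodule.span ℚ (Set.range (qst fun (b : s) j => x j b)) := by
      rw [Submodule.span_le]
      rintro _ ⟨a, rfl⟩
      have h2 : qst M a = ∑ b : s, (PM C' b a : ℚ) • qst (fun (b : s) j => x j b) b := by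
        ext j
        have := congrFun (hM a) j
        simp only [qst, this]
        simp [qst]
      change qst M a ∈ _
      rw [h2]
      exact Submodule.sum_mem _ fun b _ => Submodule.smul_mem _ _ (Submodule.subset_span ⟨b, rfl⟩)
    exact Submodule.finrank_mono hle
  · intro h0
    rw [Finset.nonempty_iff_ne_empty]
    rintro rfl
    apply h0
    ext κ j
    have := congrFun (hs κ) j
    simpa [qst] using this
  · rintro h0 rfl
    apply h0
    change LinearIndependent ℤ _
    rw [li_cast]
    let e : K ≃ (Finset.univ : Finset K) := (Equiv.subtypeUnivEquiv (by simp)).symm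
    exact (linearIndependent_equiv e).2 hli

end Cfs


section TPs
variable {d : ℕ} {ι : Type*} [Fintype ι] [DecidableEq ι]

def TP (d : ℕ) (P : Matrix ι ι ℤ) : (ι → Fin d → ℝ) →ₗ[ℝ] (ι → Fin d → ℝ) :=
  LinearMap.pi fun a => ∑ b, (P b a : ℝ) • LinearMap.proj b

theorem TP_apply (P : Matrix ι ι ℤ) (X : ι → Fin d → ℝ) (a : ι) : TP d P X a = ∑ b, (P b a : ℝ) • X b := by
  simp [TP]

def swp (d : ℕ) (ι : Type*) : (ι → Fin d → ℝ) ≃ₗ[ℝ] (Fin d → ι → ℝ) where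
  toFun := fun X j i => X i j
  invFun := fun X j i => X i j
  map_add' := fun _ _ => rfl
  map_smul' := fun _ _ => rfl
  left_inv := fun _ => rfl
  right_inv := fun _ => rfl

theorem TP_det (P : Matrix ι ι ℤ) : LinearMap.det (TP d P) = (P.det : ℝ) ^ d := by
  rw [← LinearMap.det_conj (TP d P) (swp d ι)]
  have h1 : ((swp d ι : (ι → Fin d → ℝ) →ₗ[ℝ] (Fin d → ι → ℝ)) ∘ₗ TP d P ∘ₗ ((swp d ι).symm : (Fin d → ι → ℝ) →ₗ[ℝ] (ι → Fin d → ℝ))) =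
      LinearMap.pi fun j : Fin d => (Matrix.toLin' (P.map (Int.castRingHom ℝ))ᵀ) ∘ₗ LinearMap.proj j := by
    apply LinearMap.ext
    intro X
    ext j a
    simp only [LinearMap.comp_apply, LinearMap.pi_apply, LinearMap.proj_apply, Matrix.toLin'_apply]
    change TP d P (fun i j => X j i) a j = _
    rw [TP_apply]
    simp [Matrix.mulVec, dotProduct]
  rw [h1, LinearMap.det_pi]
  simp only [LinearMap.det_toLin', Matrix.det_transpose, Finset.prod_const, Finset.card_univ, Fintype.card_fin]
  congr 1
  exact ((Int.castRingHom ℝ).map_det P).symm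

theorem vol_TP (P : Matrix ι ι ℤ) (hP : P.det ≠ 0) (A : Set (ι → Fin d → ℝ)) :
    volume (TP d P ⁻¹' A) = ENNReal.ofReal ((P.det.natAbs : ℝ) ^ d)⁻¹ * volume A := by
  have h0 : LinearMap.det (TP d P) ≠ 0 := by
    rw [TP_det]; exact pow_ne_zero _ (by exact_mod_cast hP)
  rw [Measure.addHaar_preimage_linearMap _ h0, TP_det]
  congr 2
  rw [abs_inv, abs_pow, Nat.cast_natAbs, Int.cast_abs]

theorem comp_TP (P : Matrix ι ι ℤ) (hP : P.det ≠ 0) (A : Set (ι → Fin d → ℝ)) (hA : IsCompact A) :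
    IsCompact (TP d P ⁻¹' A) := by
  have h0 : LinearMap.det (TP d P) ≠ 0 := by
    rw [TP_det]; exact pow_ne_zero _ (by exact_mod_cast hP)
  let e := (LinearMap.equivOfDetNeZero _ h0).toContinuousLinearEquiv
  exact e.toHomeomorph.isCompact_preimage.2 hA

theorem TP_act (P : Matrix ι ι ℤ) (g : SLR d) (X : ι → Fin d → ℝ) : TP d P (act g X) = act g (TP d P X) := by
  ext1 a
  rw [TP_apply, act_apply, TP_apply, Matrix.mulVec_sum]
  refine Finset.sum_congr rfl fun b _ => ?_
  rw [Matrix.mulVec_smul]; rfl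

end TPs

section Prods
variable {d r1 r2 : ℕ} {ι : Type*} [Fintype ι]

def PR (e : Fin r1 ⊕ Fin r2 ≃ ι) (B1 : Set (Fin r1 → Fin d → ℝ)) (B2 : Set (Fin r2 → Fin d → ℝ)) :
    Set (ι → Fin d → ℝ) := {X | (fun a => X (e (Sum.inl a))) ∈ B1 ∧ (fun a => X (e (Sum.inr a))) ∈ B2}

theorem vol_PR (e : Fin r1 ⊕ Fin r2 ≃ ι) (B1 : Set (Fin r1 → Fin d → ℝ)) (B2 : Set (Fin r2 → Fin d → ℝ)) :
    volume (PR e B1 B2) = volume B1 * volume B2 := by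
  have h1 := volume_measurePreserving_sumPiEquivProdPi (fun _ : Fin r1 ⊕ Fin r2 => Fin d → ℝ)
  have h2 := volume_measurePreserving_piCongrLeft (fun _ : ι => Fin d → ℝ) e
  rw [← Measure.prod_prod (μ := volume) (ν := volume)]
  change _ = volume _
  rw [← h1.measure_preimage_equiv, ← h2.measure_preimage_equiv]
  congr 1
  ext X
  simp only [PR, Set.mem_preimage, Set.mem_setOf_eq, Set.mem_prod]
  have h3 : ∀ a, (MeasurableEquiv.piCongrLeft (fun _ : ι => Fin d → ℝ) e) X (e a) = X a := by
    intro a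
    exact Equiv.piCongrLeft_apply_apply (P := fun _ : ι => Fin d → ℝ) e X a
  simp only [h3]
  rfl

theorem comp_PR (e : Fin r1 ⊕ Fin r2 ≃ ι) (B1 : Set (Fin r1 → Fin d → ℝ)) (B2 : Set (Fin r2 → Fin d → ℝ))
    (h1 : IsCompact B1) (h2 : IsCompact B2) : IsCompact (PR e B1 B2) := by
  let f : (Fin r1 → Fin d → ℝ) × (Fin r2 → Fin d → ℝ) → (ι → Fin d → ℝ) := fun x c => Sum.elim x.1 x.2 (e.symm c)
  have hf : Continuous f := by
    refine continuous_pi fun c => ?_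
    rcases h : e.symm c with a | a
    · simp only [f, h, Sum.elim_inl]; fun_prop
    · simp only [f, h, Sum.elim_inr]; fun_prop
  have : PR e B1 B2 = f '' (B1 ×ˢ B2) := by
    ext X
    constructor
    · intro h
      refine ⟨(_, _), ⟨h.1, h.2⟩, ?_⟩
      ext1 c
      simp only [f]
      obtain ⟨x, rfl⟩ := e.surjective c
      rcases x with a | a <;> simp
    · rintro ⟨x, hx, rfl⟩
      simpa [PR, f] using hx
  rw [this]
  exact (h1.prod h2).image hf

end Prods

section Enum
variable {k : ℕ}

def enS (s : Finset (Fin k ⊕ Fin k)) : Fin s.toLeft.card ⊕ Fin s.toRight.card ≃ s :=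
  Equiv.ofBijective (Sum.elim (fun a => ⟨Sum.inl (s.toLeft.orderEmbOfFin rfl a), by
      have := s.toLeft.orderEmbOfFin_mem rfl a
      exact Finset.mem_toLeft.1 this⟩)
    (fun a => ⟨Sum.inr (s.toRight.orderEmbOfFin rfl a), by
      have := s.toRight.orderEmbOfFin_mem rfl a
      exact Finset.mem_toRight.1 this⟩)) (by
    constructor
    · rintro (a | a) (b | b) h
      · simpa using h
      · simp at h
      · simp at h
      · simpa using h
    · rintro ⟨a | a, ha⟩
      · have h1 : a ∈ Set.range (s.toLeft.orderEmbOfFin rfl) := by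
          rw [Finset.range_orderEmbOfFin]; simpa using ha
        obtain ⟨b, hb⟩ := h1
        exact ⟨Sum.inl b, by simp [hb]⟩
      · have h1 : a ∈ Set.range (s.toRight.orderEmbOfFin rfl) := by
          rw [Finset.range_orderEmbOfFin]; simpa using ha
        obtain ⟨b, hb⟩ := h1
        exact ⟨Sum.inr b, by simp [hb]⟩)

theorem enS_inl (s : Finset (Fin k ⊕ Fin k)) (a : Fin s.toLeft.card) : 
  (enS s (Sum.inl a) : Fin k ⊕ Fin k) = Sum.inl (s.toLeft.orderEmbOfFin rfl a) := rfl
theorem enS_inr (s : Finset (Fin k ⊕ Fin k)) (a : Fin s.toRight.card) : 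
  (enS s (Sum.inr a) : Fin k ⊕ Fin k) = Sum.inr (s.toRight.orderEmbOfFin rfl a) := rfl

end Enum


section Key
variable {d : ℕ} {K : Type*} [Fintype K] [DecidableEq K]

abbrev Idx (K : Type*) [Fintype K] [DecidableEq K] :=
  Σ s : {s : Finset K // s.Nonempty ∧ s ≠ Finset.univ}, Cf K s.1

def Rec (x : Σ i : Idx K, (i.1.1 → Fin d → ℤ)) : K → Fin d → ℚ := fun κ =>
  ∑ a : x.1.1.1, x.1.2.1 κ a • ∑ b, (PM x.1.2 b a : ℚ) • qst x.2 b

theorem key (g : SLR d) (EE : Set (K → Fin d → ℝ)) (A : (s : Finset K) → Set (s → Fin d → ℝ))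
    (hA : ∀ X ∈ EE, ∀ s : Finset K, s.Nonempty → s ≠ Finset.univ → (fun a : s => X a) ∈ A s) :
    SF Set.univ EE g ≤ EE.indicator 1 0 + SF (LI d K) EE g +
      ∑' i : Idx K, SF (LI d i.1.1) (TP d (PM i.2) ⁻¹' A i.1.1) g := by
  classical
  let T : Set (K → Fin d → ℤ) := {M | M ≠ 0 ∧ M ∉ LI d K ∧ act g (cst M) ∈ EE}
  let f : (Σ i : Idx K, (i.1.1 → Fin d → ℤ)) → ℝ≥0∞ := fun x =>
    (LI d x.1.1.1).indicator 1 x.2 * (TP d (PM x.1.2) ⁻¹' A x.1.1.1).indicator 1 (act g (cst x.2))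
  have hT : ∑' M, T.indicator (fun _ => (1:ℝ≥0∞)) M ≤
      ∑' i : Idx K, SF (LI d i.1.1) (TP d (PM i.2) ⁻¹' A i.1.1) g := by
    have h1 : ∀ M : T, ∃ x : Σ i : Idx K, (i.1.1 → Fin d → ℤ), Rec x = qst M.1 ∧ f x = 1 := by
      rintro ⟨M, h0, h2, h3⟩
      obtain ⟨s, C, W, hW, hM, hC, hs1, hs2⟩ := decomp M
      refine ⟨⟨⟨⟨s, hs1 h0, hs2 h2⟩, C⟩, W⟩, ?_, ?_⟩
      · ext1 κ
        rw [hC κ]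
        refine Finset.sum_congr rfl fun a _ => ?_
        congr 1
        ext j
        simp only [qst, hM a]
        simp [qst]
      · have h5 : TP d (PM C) (act g (cst W)) = fun a : s => act g (cst M) a := by
          rw [TP_act]
          ext1 a
          rw [act_apply, act_apply]
          congr 1
          rw [TP_apply]
          ext j
          simp only [cst, hM a]
          simp [cst]
        have h4 : TP d (PM C) (act g (cst W)) ∈ A s := by
          rw [h5]; exact hA _ h3 s (hs1 h0) (hs2 h2)
        have h6 : act g (cst W) ∈ TP d (PM C) ⁻¹' A s := h4
        simp only [f]
        rw [Set.indicator_of_mem hW, Set.indicator_of_mem h6]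
        simp
    choose φ hφ1 hφ2 using h1
    have hinj : Function.Injective φ := by
      intro M M' h
      have h7 : qst M.1 = qst M'.1 := by rw [← hφ1, ← hφ1, h]
      apply Subtype.ext
      ext i j
      have := congrFun (congrFun h7 i) j
      simpa [qst] using this
    rw [← tsum_subtype]
    calc ∑' M : T, (1:ℝ≥0∞) = ∑' M : T, f (φ M) := by simp only [hφ2]
      _ ≤ ∑' x, f x := ENNReal.tsum_comp_le_tsum_of_injective hinj f
      _ = _ := ENNReal.tsum_sigma' f
  refine le_trans ?_ (add_le_add_right hT _)
  have h0 : (EE.indicator 1 0 : ℝ≥0∞) = ∑' M : K → Fin d → ℤ, if M = 0 then EE.indicator 1 0 else 0 := by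
    rw [tsum_ite_eq]
  rw [h0, SF, SF, ← ENNReal.tsum_add, ← ENNReal.tsum_add]
  refine ENNReal.tsum_le_tsum fun M => ?_
  by_cases hM : M = 0
  · subst hM
    have : act g (cst (0 : K → Fin d → ℤ)) = 0 := by
      have : (cst (0 : K → Fin d → ℤ)) = 0 := by ext; simp [cst]
      rw [this, map_zero]
    rw [this]
    simp [add_assoc]
  · by_cases hE : act g (cst M) ∈ EE
    · by_cases hL : M ∈ LI d K
      · simp [hM, hE, hL]
      · have : M ∈ T := ⟨hM, hL, hE⟩
        simp [hM, hE, hL, this]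
    · simp [hE]

def Tot (d : ℕ) (K : Type*) [Fintype K] [DecidableEq K] : ℝ≥0∞ :=
  ∑' i : Idx K, ENNReal.ofReal ((DD i.2 : ℝ) ^ d)⁻¹

theorem Tot_fin (h : ∀ r, (Fintype.card K - r) * r + 2 ≤ d) : Tot d K ≠ ∞ := by
  unfold Tot
  rw [ENNReal.tsum_sigma', tsum_fintype]
  exact ENNReal.sum_ne_top.2 fun s _ => sum_fin d s.1 (h _)

theorem second (μ : Measure (Xspace d)) [IsProbabilityMeasure μ]
    (hμ : ∀ γ : SLR d, Measure.map (fun x => γ • x) μ = μ) (h : Fintype.card K < d)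
    (EE EC : Set (K → Fin d → ℝ)) (hEC : IsCompact EC) (hE : EE ⊆ EC) (A : (s : Finset K) → Set (s → Fin d → ℝ))
    (hA : ∀ X ∈ EE, ∀ s : Finset K, s.Nonempty → s ≠ Finset.univ → (fun a : s => X a) ∈ A s)
    (hc : ∀ s, IsCompact (A s)) (S : ℝ≥0∞) 
    (hS : ∀ s : Finset K, s.Nonempty → s ≠ Finset.univ → volume (A s) ≤ S) :
    ∫⁻ x, SFX Set.univ stab_univ EE x ∂μ ≤ EE.indicator 1 0 + volume EC + Tot d K * S := by
  have h1 : ∀ x, SFX Set.univ stab_univ EE x ≤ EE.indicator 1 0 + SFX (LI d K) stab_LI EC x +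
      ∑' i : Idx K, SFX (LI d i.1.1) stab_LI (TP d (PM i.2) ⁻¹' A i.1.1) x := by
    intro x
    obtain ⟨g, rfl⟩ := QuotientGroup.mk_surjective x
    simp only [SFX_mk]
    refine (key g EE A hA).trans ?_
    gcongr
    unfold SF
    refine ENNReal.tsum_le_tsum fun V => ?_
    gcongr
  have hm : ∀ i : Idx K, Measurable (SFX (LI d i.1.1) stab_LI (TP d (PM i.2) ⁻¹' A i.1.1)) := fun i =>
    meas_SFX _ _ _ (comp_TP _ (PM_det _) _ (hc _)).measurableSet
  calc _ ≤ ∫⁻ x, (EE.indicator 1 0 + SFX (LI d K) stab_LI EC x +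
      ∑' i : Idx K, SFX (LI d i.1.1) stab_LI (TP d (PM i.2) ⁻¹' A i.1.1) x) ∂μ := lintegral_mono h1
    _ = EE.indicator 1 0 + ∫⁻ x, SFX (LI d K) stab_LI EC x ∂μ + 
      ∑' i : Idx K, ∫⁻ x, SFX (LI d i.1.1) stab_LI (TP d (PM i.2) ⁻¹' A i.1.1) x ∂μ := by
        rw [lintegral_add_right _ (Measurable.tsum hm), lintegral_tsum fun i => (hm i).aemeasurable,
          lintegral_add_left measurable_const]
        simp
    _ ≤ _ := by
        gcongr
        · exact meanU μ hμ h EC hEC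
        · unfold Tot
          rw [← ENNReal.tsum_mul_right]
          refine ENNReal.tsum_le_tsum fun i => ?_
          refine (meanU μ hμ (lt_of_le_of_lt ?_ h) _ (comp_TP _ (PM_det _) _ (hc _))).trans ?_
          · simpa using i.1.1.card_le_univ
          · rw [vol_TP _ (PM_det _)]
            exact mul_le_mul_right (hS _ i.1.2.1 i.1.2.2) _

theorem SF_card (g : SLR d) (A : Set (K → Fin d → ℝ)) (hA : Bornology.IsBounded A) :
    {V : K → Fin d → ℤ | act g (cst V) ∈ A}.Finite ∧
    SF Set.univ A g = (Nat.card {V : K → Fin d → ℤ | act g (cst V) ∈ A} : ℝ≥0∞) := by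
  have hf : {V : K → Fin d → ℤ | act g (cst V) ∈ A}.Finite := by
    obtain ⟨R, hR⟩ := hA.exists_norm_le
    obtain ⟨c, hc, h⟩ := act_bound (ι := K) g
    have : {V : K → Fin d → ℤ | act g (cst V) ∈ A} ⊆ Metric.closedBall 0 (c * R) := by
      intro V hV
      have h1 : ‖cst V‖ ≤ c * R := (h _).trans (by gcongr; exact hR _ hV)
      have h0 : 0 ≤ c * R := (norm_nonneg _).trans h1
      rw [mem_closedBall_zero_iff]
      refine (pi_norm_le_iff_of_nonneg h0).2 fun i => (pi_norm_le_iff_of_nonneg h0).2 fun j => ?_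
      refine le_trans ?_ ((norm_le_pi_norm (cst V i) j).trans ((norm_le_pi_norm _ i).trans h1))
      simp [cst, Int.norm_eq_abs]
    exact (isCompact_closedBall _ _).finite_of_discrete.subset this
  refine ⟨hf, ?_⟩
  have : ∀ V : K → Fin d → ℤ, (Set.univ.indicator 1 V * A.indicator 1 (act g (cst V)) : ℝ≥0∞) = 
      {V : K → Fin d → ℤ | act g (cst V) ∈ A}.indicator (fun _ => 1) V := by
    intro V
    by_cases hV : act g (cst V) ∈ A <;> simp [hV]
  unfold SF
  simp only [this]
  rw [← tsum_subtype, ENNReal.tsum_one]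
  haveI := hf.to_subtype
  rw [ENat.card_eq_coe_natCard]
  rfl
end Key


section Fin
variable {d k : ℕ}

theorem SF_sq (g : SLR d) (E : Set (Fin k → Fin d → ℝ)) :
    SF Set.univ (PR (Equiv.refl (Fin k ⊕ Fin k)) E E) g = SF Set.univ E g ^ 2 := by
  unfold SF
  rw [← (Equiv.sumArrowEquivProdArrow (Fin k) (Fin k) (Fin d → ℤ)).symm.tsum_eq, ENNReal.tsum_prod', sq,
    ← ENNReal.tsum_mul_right]
  refine tsum_congr fun V => ?_
  rw [← ENNReal.tsum_mul_left]
  refine tsum_congr fun W => ?_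
  have h : act g (cst ((Equiv.sumArrowEquivProdArrow (Fin k) (Fin k) (Fin d → ℤ)).symm (V, W))) ∈
      PR (Equiv.refl (Fin k ⊕ Fin k)) E E ↔ act g (cst V) ∈ E ∧ act g (cst W) ∈ E := Iff.rfl
  by_cases h1 : act g (cst V) ∈ E <;> by_cases h2 : act g (cst W) ∈ E <;> simp [Set.indicator, h, h1, h2]

def Bs (d : ℕ) (Er : (r : ℕ) → Set (Fin r → Fin d → ℝ)) (r : ℕ) : Set (Fin r → Fin d → ℝ) :=
  if r = 0 then Set.univ else closure (Er r)

theorem Bs_comp (Er : (r : ℕ) → Set (Fin r → Fin d → ℝ))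
    (h : ∀ r, 1 ≤ r → r ≤ k → JordanMeasurable (Er r)) (r : ℕ) (hr : r ≤ k) : IsCompact (Bs d Er r) := by
  unfold Bs
  split_ifs with h0
  · subst h0; exact isCompact_univ
  · exact (h r (by omega) hr).1.isCompact_closure

theorem Bs_vol (Er : (r : ℕ) → Set (Fin r → Fin d → ℝ))
    (h : ∀ r, 1 ≤ r → r ≤ k → JordanMeasurable (Er r)) (r : ℕ) (hr : r ≤ k) : 
    volume (Bs d Er r) = ENNReal.ofReal (jvol d r (Er r)) := by
  unfold Bs jvol
  split_ifs with h0
  · subst h0; simp [volume_pi, Measure.pi_univ]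
  · have hj := h r (by omega) hr
    rw [measure_closure_of_null_frontier hj.2, ENNReal.ofReal_toReal hj.1.measure_lt_top.ne]

theorem jvol_nonneg (r : ℕ) (S : Set (Fin r → Fin d → ℝ)) : 0 ≤ jvol d r S := by
  unfold jvol; split_ifs <;> positivity

def As (d : ℕ) (Er : (r : ℕ) → Set (Fin r → Fin d → ℝ)) (s : Finset (Fin k ⊕ Fin k)) :
    Set (s → Fin d → ℝ) := PR (enS s) (Bs d Er s.toLeft.card) (Bs d Er s.toRight.card)

theorem tL_le (s : Finset (Fin k ⊕ Fin k)) : s.toLeft.card ≤ k := by simpa using s.toLeft.card_le_univ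
theorem tR_le (s : Finset (Fin k ⊕ Fin k)) : s.toRight.card ≤ k := by simpa using s.toRight.card_le_univ

theorem Bs_mem (E : Set (Fin k → Fin d → ℝ)) (Er : (r : ℕ) → Set (Fin r → Fin d → ℝ))
    (h : ∀ r, 1 ≤ r → r ≤ k → ∀ j : Fin r → Fin k, StrictMono j →
          ∀ v ∈ E, (fun a => v (j a)) ∈ Er r) (r : ℕ) (hr : r ≤ k) (j : Fin r → Fin k) (hj : StrictMono j)
    (v : Fin k → Fin d → ℝ) (hv : v ∈ E) : (fun a => v (j a)) ∈ Bs d Er r := by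
  unfold Bs
  split_ifs with h0
  · trivial
  · exact subset_closure (h r (by omega) hr j hj v hv)

theorem low (hk : 1 ≤ k) (hkd : k < d) (μ : Measure (Xspace d)) [IsProbabilityMeasure μ]
    (hμ : ∀ γ : SLR d, Measure.map (fun x => γ • x) μ = μ) (E : Set (Fin k → Fin d → ℝ))
    (hE : JordanMeasurable E) : E.indicator 1 0 + volume E ≤ ∫⁻ x, SFX Set.univ stab_univ E x ∂μ := by
  classical
  let O := interior E \ {0}
  have hO : IsOpen O := isOpen_interior.sdiff isClosed_singleton
  haveI : Nonempty (Fin k) := ⟨⟨0, by omega⟩⟩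
  haveI : Nonempty (Fin d) := ⟨⟨0, by omega⟩⟩
  have hv : volume O = volume E := by
    rw [← measure_interior_of_null_frontier hE.2]
    exact measure_sdiff_null (measure_singleton _)
  have h1 : ∀ x, E.indicator 1 0 + SFX Set.univ stab_univ O x ≤ SFX Set.univ stab_univ E x := by
    intro x
    obtain ⟨g, rfl⟩ := QuotientGroup.mk_surjective x
    simp only [SFX_mk]
    have h0 : (E.indicator 1 0 : ℝ≥0∞) = ∑' M : Fin k → Fin d → ℤ, if M = 0 then E.indicator 1 0 else 0 := by
      rw [tsum_ite_eq]
    rw [h0, SF, SF, ← ENNReal.tsum_add]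
    refine ENNReal.tsum_le_tsum fun M => ?_
    by_cases hM : M = 0
    · subst hM
      have : act g (cst (0 : Fin k → Fin d → ℤ)) = 0 := by
        have : (cst (0 : Fin k → Fin d → ℤ)) = 0 := by ext; simp [cst]
        rw [this, map_zero]
      rw [this]
      simp [O]
    · have hs : O ⊆ E := fun x hx => interior_subset hx.1
      simp only [hM, if_false, zero_add]
      gcongr
  calc _ = E.indicator 1 0 + volume O := by rw [hv]
    _ ≤ E.indicator 1 0 + ∫⁻ x, SFX Set.univ stab_univ O x ∂μ := by
        gcongr
        exact meanL μ hμ (by simpa using hkd) O hO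
    _ = ∫⁻ x, (E.indicator 1 0 + SFX Set.univ stab_univ O x) ∂μ := by
        rw [lintegral_add_left measurable_const]; simp
    _ ≤ _ := lintegral_mono h1

end Fin

theorem final (d k : ℕ) (hk : 1 ≤ k) (hd : 2 ≤ d) (hdk : k^2 + 3 ≤ d) :
    ∃ C > (0:ℝ),
      ∀ (E : Set (Fin k → Fin d → ℝ)) (Er : (r : ℕ) → Set (Fin r → Fin d → ℝ)),
        Er k = E →
        (∀ r, 1 ≤ r → r ≤ k → JordanMeasurable (Er r)) →
        (∀ r, 1 ≤ r → r ≤ k → ∀ j : Fin r → Fin k, StrictMono j →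
          ∀ v ∈ E, (fun a => v (j a)) ∈ Er r) →
        ∀ μ : Measure (Xspace d), IsProbabilityMeasure μ →
          (∀ γ : SLR d, Measure.map (fun x => γ • x) μ = μ) →
          ∀ Φ : Xspace d → ℝ,
            (∀ g : SLR d, Φ (QuotientGroup.mk g) =
              (Nat.card {v : Fin k → (Fin d → ℤ) |
                (fun i => (g : Matrix (Fin d) (Fin d) ℝ).mulVec
                  (fun j => ((v i j : ℤ) : ℝ))) ∈ E} : ℝ)) →
            0 ≤ (∫ x, (Φ x)^2 ∂μ) - (∫ x, Φ x ∂μ)^2 ∧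
            (∫ x, (Φ x)^2 ∂μ) - (∫ x, Φ x ∂μ)^2 ≤
              C * sSup {x : ℝ | ∃ r1 r2 : ℕ, r1 ≤ k ∧ r2 ≤ k ∧ 1 ≤ r1 + r2 ∧
                r1 + r2 ≤ 2*k - 1 ∧ x = jvol d r1 (Er r1) * jvol d r2 (Er r2)} := by
  have hTot : Tot d (Fin k ⊕ Fin k) ≠ ∞ := by
    apply Tot_fin
    intro r
    have : Fintype.card (Fin k ⊕ Fin k) = 2 * k := by simp; ring
    rw [this]
    rcases le_total r (2 * k) with h | h
    · obtain ⟨t, ht⟩ := Nat.exists_eq_add_of_le h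
      have h2 : t * r ≤ k ^ 2 := by
        zify at ht ⊢
        nlinarith [sq_nonneg ((t:ℤ) - r)]
      have h3 : 2 * k - r = t := by omega
      rw [h3]; omega
    · have h3 : 2 * k - r = 0 := by omega
      rw [h3]; omega
  have h2k : 2 * k < d := by nlinarith [sq_nonneg ((k:ℤ) - 1)]
  refine ⟨(Tot d (Fin k ⊕ Fin k)).toReal + 1, by positivity, ?_⟩
  intro E Er hEk hJ hproj μ hμ1 hμ Φ hΦ
  set SS : Set ℝ := {x : ℝ | ∃ r1 r2 : ℕ, r1 ≤ k ∧ r2 ≤ k ∧ 1 ≤ r1 + r2 ∧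
                r1 + r2 ≤ 2*k - 1 ∧ x = jvol d r1 (Er r1) * jvol d r2 (Er r2)} with hSS
  have hfin : SS.Finite := by
    refine Set.Finite.subset (((Set.finite_Iic k).prod (Set.finite_Iic k)).image
      (fun p : ℕ × ℕ => jvol d p.1 (Er p.1) * jvol d p.2 (Er p.2))) ?_
    rintro x ⟨r1, r2, h1, h2, -, -, rfl⟩
    exact ⟨(r1, r2), ⟨h1, h2⟩, rfl⟩
  have hsup : 0 ≤ sSup SS := by
    apply Real.sSup_nonneg
    rintro x ⟨r1, r2, -, -, -, -, rfl⟩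
    exact mul_nonneg (jvol_nonneg _ _) (jvol_nonneg _ _)
  have hEJ : JordanMeasurable E := hEk ▸ hJ k hk le_rfl
  have hF : ∀ x, SFX Set.univ stab_univ E x = ENNReal.ofReal (Φ x) := by
    intro x
    obtain ⟨g, rfl⟩ := QuotientGroup.mk_surjective x
    rw [SFX_mk, hΦ, (SF_card g E hEJ.1).2, ENNReal.ofReal_natCast]
    rfl
  have hΦ0 : ∀ x, 0 ≤ Φ x := by
    intro x
    obtain ⟨g, rfl⟩ := QuotientGroup.mk_surjective x
    rw [hΦ]; positivity
  have hF2 : ∀ x, SFX Set.univ stab_univ (PR (Equiv.refl (Fin k ⊕ Fin k)) E E) x = ENNReal.ofReal (Φ x ^ 2) := by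
    intro x
    rw [ENNReal.ofReal_pow (hΦ0 x), ← hF]
    obtain ⟨g, rfl⟩ := QuotientGroup.mk_surjective x
    exact SF_sq g E
  by_cases hm : AEStronglyMeasurable Φ μ
  swap
  · have hm2 : ¬ AEStronglyMeasurable (fun x => Φ x ^ 2) μ := by
      intro h
      apply hm
      have h3 := Real.continuous_sqrt.comp_aestronglyMeasurable h
      refine h3.congr (ae_of_all _ fun x => ?_)
      exact Real.sqrt_sq (hΦ0 x)
    rw [integral_non_aestronglyMeasurable hm, integral_non_aestronglyMeasurable hm2]
    refine ⟨by simp, ?_⟩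
    simp only [ne_eq, OfNat.ofNat_ne_zero, not_false_eq_true, zero_pow, sub_zero]
    positivity
  have hcE : IsCompact (closure E) := hEJ.1.isCompact_closure
  have hvE : volume E ≠ ∞ := hEJ.1.measure_lt_top.ne
  have hup := second μ hμ (by simpa [← two_mul] using h2k) (PR (Equiv.refl (Fin k ⊕ Fin k)) E E)
    (PR (Equiv.refl (Fin k ⊕ Fin k)) (closure E) (closure E)) (comp_PR _ _ _ hcE hcE)
    (fun X hX => ⟨subset_closure hX.1, subset_closure hX.2⟩) (As d Er)
    (by
      intro X hX s _ _
      exact ⟨Bs_mem E Er hproj _ (tL_le s) (s.toLeft.orderEmbOfFin rfl) (OrderEmbedding.strictMono _) _ hX.1,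
        Bs_mem E Er hproj _ (tR_le s) (s.toRight.orderEmbOfFin rfl) (OrderEmbedding.strictMono _) _ hX.2⟩)
    (fun s => comp_PR _ _ _ (Bs_comp Er hJ _ (tL_le s)) (Bs_comp Er hJ _ (tR_le s)))
    (ENNReal.ofReal (sSup SS))
    (by
      intro s h1 h2
      unfold As
      rw [vol_PR, Bs_vol Er hJ _ (tL_le s), Bs_vol Er hJ _ (tR_le s), ← ENNReal.ofReal_mul (jvol_nonneg _ _)]
      apply ENNReal.ofReal_le_ofReal
      apply le_csSup hfin.bddAbove
      have h3 := Finset.card_toLeft_add_card_toRight (u := s)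
      have h4 := h1.card_pos
      have h5 := (Finset.card_lt_iff_ne_univ s).2 h2
      simp only [Fintype.card_sum, Fintype.card_fin] at h5
      exact ⟨_, _, tL_le s, tR_le s, by omega, by omega, rfl⟩)
  have hlow := low hk (by omega) μ hμ E hEJ
  rw [vol_PR, measure_closure_of_null_frontier hEJ.2] at hup
  simp only [hF, hF2] at hup hlow
  have ha : ∃ a : ℝ, (a = 0 ∨ a = 1) ∧ E.indicator (1 : (Fin k → Fin d → ℝ) → ℝ≥0∞) 0 = ENNReal.ofReal a ∧ 
     (PR (Equiv.refl (Fin k ⊕ Fin k)) E E).indicator (1 : (Fin k ⊕ Fin k → Fin d → ℝ) → ℝ≥0∞) 0 = ENNReal.ofReal a := by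
    have hi : (0 : Fin k ⊕ Fin k → Fin d → ℝ) ∈ PR (Equiv.refl (Fin k ⊕ Fin k)) E E ↔ 
      (0 : Fin k → Fin d → ℝ) ∈ E := and_self_iff
    by_cases h : (0 : Fin k → Fin d → ℝ) ∈ E
    · exact ⟨1, Or.inr rfl, by simp [h], by simp [hi, h]⟩
    · exact ⟨0, Or.inl rfl, by simp [h], by simp [hi, h]⟩
  obtain ⟨a, ha01, ha1, ha2⟩ := ha
  have ha0 : 0 ≤ a := by rcases ha01 with rfl | rfl <;> norm_num
  obtain ⟨v, hv0, hv⟩ : ∃ v : ℝ, 0 ≤ v ∧ volume E = ENNReal.ofReal v := 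
    ⟨_, ENNReal.toReal_nonneg, (ENNReal.ofReal_toReal hvE).symm⟩
  obtain ⟨t, ht0, ht, htt⟩ : ∃ t : ℝ, 0 ≤ t ∧ Tot d (Fin k ⊕ Fin k) = ENNReal.ofReal t ∧ 
      (Tot d (Fin k ⊕ Fin k)).toReal = t := 
    ⟨_, ENNReal.toReal_nonneg, (ENNReal.ofReal_toReal hTot).symm, rfl⟩
  rw [htt]
  have hts := mul_nonneg ht0 hsup
  rw [ha2, hv, ht, ← ENNReal.ofReal_mul hv0, ← ENNReal.ofReal_mul ht0, ← ENNReal.ofReal_add ha0 (by positivity),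
    ← ENNReal.ofReal_add (by positivity) hts] at hup
  rw [ha1, hv, ← ENNReal.ofReal_add ha0 hv0] at hlow
  have hm2 : AEStronglyMeasurable (fun x => Φ x ^ 2) μ := hm.pow 2
  have hi2 : Integrable (fun x => Φ x ^ 2) μ := by
    refine ⟨hm2, ?_⟩
    rw [hasFiniteIntegral_iff_ofReal (ae_of_all _ fun x => sq_nonneg _)]
    exact hup.trans_lt ENNReal.ofReal_lt_top
  have hL2 : MemLp Φ 2 μ := (memLp_two_iff_integrable_sq hm).2 hi2
  have hi1 : Integrable Φ μ := hL2.integrable (by norm_num)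
  have hup2 : ∫ x, Φ x ^ 2 ∂μ ≤ a + v * v + t * sSup SS := by
    rw [← ofReal_integral_eq_lintegral_ofReal hi2 (ae_of_all _ fun x => sq_nonneg _)] at hup
    exact (ENNReal.ofReal_le_ofReal_iff (by positivity)).1 hup
  have hlow2 : a + v ≤ ∫ x, Φ x ∂μ := by
    rw [← ofReal_integral_eq_lintegral_ofReal hi1 (ae_of_all _ hΦ0)] at hlow
    exact (ENNReal.ofReal_le_ofReal_iff (integral_nonneg hΦ0)).1 hlow
  constructor
  · have h1 := ProbabilityTheory.variance_nonneg Φ μ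
    rw [ProbabilityTheory.variance_eq_sub hL2] at h1
    exact h1
  · have h5 : (a + v) ^ 2 ≤ (∫ x, Φ x ∂μ) ^ 2 := pow_le_pow_left₀ (by positivity) hlow2 2
    have h6 : a ^ 2 = a := by rcases ha01 with rfl | rfl <;> norm_num
    nlinarith [mul_nonneg ha0 hv0]

/-- Theorem 4.4 (Rogers-type second moment bound): for `d ≥ k² + 3` and a Jordan
measurable `E ⊆ (ℝ^d)^k` admitting projection bounds `(E_r)`, the variance of the rank-`k`
Siegel transform of `χ_E` is at most
`C · max{vol_{r₁}(E_{r₁})·vol_{r₂}(E_{r₂}) : 1 ≤ r₁+r₂ ≤ 2k-1}` with `C = C(d,k)`. -/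
theorem stmt7 (d k : ℕ) (hk : 1 ≤ k) (hd : 2 ≤ d) (hdk : k^2 + 3 ≤ d) :
    ∃ C > (0:ℝ),
      ∀ (E : Set (Fin k → Fin d → ℝ)) (Er : (r : ℕ) → Set (Fin r → Fin d → ℝ)),
        Er k = E →
        (∀ r, 1 ≤ r → r ≤ k → JordanMeasurable (Er r)) →
        (∀ r, 1 ≤ r → r ≤ k → ∀ j : Fin r → Fin k, StrictMono j →
          ∀ v ∈ E, (fun a => v (j a)) ∈ Er r) →
        ∀ μ : Measure (Xspace d), IsProbabilityMeasure μ →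
          (∀ γ : SLR d, Measure.map (fun x => γ • x) μ = μ) →
          ∀ Φ : Xspace d → ℝ,
            (∀ g : SLR d, Φ (QuotientGroup.mk g) =
              (Nat.card {v : Fin k → (Fin d → ℤ) |
                (fun i => (g : Matrix (Fin d) (Fin d) ℝ).mulVec
                  (fun j => ((v i j : ℤ) : ℝ))) ∈ E} : ℝ)) →
            0 ≤ (∫ x, (Φ x)^2 ∂μ) - (∫ x, Φ x ∂μ)^2 ∧
            (∫ x, (Φ x)^2 ∂μ) - (∫ x, Φ x ∂μ)^2 ≤
              C * sSup {x : ℝ | ∃ r1 r2 : ℕ, r1 ≤ k ∧ r2 ≤ k ∧ 1 ≤ r1 + r2 ∧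
                r1 + r2 ≤ 2*k - 1 ∧ x = jvol d r1 (Er r1) * jvol d r2 (Er r2)} := by
  exact final d k hk hd hdk
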